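/- arXiv:0907.5010 — 6 statements merged into one kernel-verified Lean document; each statement's English description precedes it below -/
import Mathlib

section
/- Let G be a finitely generated group, N a normal subgroup of G, and p : G → Q the quotient map onto Q = G/N. Assume Q has no nontrivial finite quotients and H₂(Q;ℤ) = 0. Let P = {(g,g') ∈ G × G : p(g) = p(g')} be the fibre product. Then the inclusion P ↪ G × G induces an isomorphism of profinite completions; that is: (a) every homomorphism from G × G onto a finite group remains surjective when restricted to P, and (b) for every finite-index normal subgroup M of P there exists a finite-index normal subgroup L of G × G with L ∩ P ≤ M. -/
/-- A group `Q` has no nontrivial finite quotients: every homomorphism from `Q`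
to a finite group is trivial. -/
def NoNontrivialFiniteQuotients (Q : Type*) [Group Q] : Prop :=
  ∀ (H : Type) [Group H] [Finite H] (f : Q →* H) (q : Q), f q = 1

/-- The map of profinite completions induced by the inclusion of the subgroup `P` of `Γ`
is surjective: every homomorphism from `Γ` onto a finite group remains surjective when
restricted to `P`. -/
def ProfiniteSurj {Γ : Type*} [Group Γ] (P : Subgroup Γ) : Prop :=
  ∀ (H : Type) [Group H] [Finite H] (f : Γ →* H),
    Function.Surjective f → Function.Surjective (f.comp P.subtype)

/-- The map of profinite completions induced by the inclusion of the subgroup `P` of `Γ`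
is injective: for every finite-index normal subgroup `M` of `P` there is a finite-index
normal subgroup `L` of `Γ` with `L ∩ P ≤ M`. -/
def ProfiniteInj {Γ : Type*} [Group Γ] (P : Subgroup Γ) : Prop :=
  ∀ M : Subgroup ↥P, M.Normal → M.FiniteIndex →
    ∃ L : Subgroup Γ, L.Normal ∧ L.FiniteIndex ∧ L.subgroupOf P ≤ M

/-- The second group homology `H₂(Q;ℤ)` with trivial ℤ-coefficients, realized via Hopf's
formula `H₂(Q;ℤ) ≅ (R ∩ [F,F])/[F,R]` for the free presentation `1 → R → F → Q → 1`
with `F` the free group on the underlying set of `Q`. -/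
def H2 (Q : Type*) [Group Q] : Type _ :=
  ↥((FreeGroup.lift (id : Q → Q)).ker ⊓ commutator (FreeGroup Q)) ⧸
    ((⁅(⊤ : Subgroup (FreeGroup Q)), (FreeGroup.lift (id : Q → Q)).ker⁆).subgroupOf
      ((FreeGroup.lift (id : Q → Q)).ker ⊓ commutator (FreeGroup Q)))

/-- A group is finitely presented if it admits a presentation with finitely many
generators and finitely many relators. -/
def FinitelyPresentedGroup (Q : Type*) [Group Q] : Prop :=
  ∃ (k : ℕ) (R : Finset (FreeGroup (Fin k))),
    Nonempty (PresentedGroup (↑R : Set (FreeGroup (Fin k))) ≃* Q)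

/-- A group `G` is residually finite if every nontrivial element is detected by a
homomorphism to a finite group. -/
def ResiduallyFinite (G : Type*) [Group G] : Prop :=
  ∀ g : G, g ≠ 1 → ∃ (H : Type) (_ : Group H) (_ : Finite H) (f : G →* H), f g ≠ 1

/-- The fibre product `P = {(g,g') : p g = p g'}` of a homomorphism `p : G →* Q`,
as a subgroup of `G × G`. -/
def fiberProduct {G Q : Type*} [Group G] [Group Q] (p : G →* Q) : Subgroup (G × G) where
  carrier := {x | p x.1 = p x.2}
  one_mem' := rfl
  mul_mem' := by
    intro a b ha hb
    simp only [Set.mem_setOf_eq, Prod.fst_mul, Prod.snd_mul, map_mul] at *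
    rw [ha, hb]
  inv_mem' := by
    intro a ha
    simp only [Set.mem_setOf_eq, Prod.fst_inv, Prod.snd_inv, map_inv] at *
    rw [ha]

theorem Subgroup.FiniteIndex.comap {G H : Type*} [Group G] [Group H] {K : Subgroup H}
    (hK : K.FiniteIndex) (f : G →* H) : (K.comap f).FiniteIndex := by
  constructor
  rw [Subgroup.index_comap]
  exact Subgroup.FiniteIndex.index_ne_zero

namespace NoNontrivialFiniteQuotients

variable {Q : Type*} [Group Q]

theorem subsingleton_of_surjective (hQ : NoNontrivialFiniteQuotients Q) {H : Type*} [Group H]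
    [Finite H] (f : Q →* H) (hf : Function.Surjective f) : Subsingleton H := by
  have key : ∀ h : H, h = 1 := by
    intro h
    obtain ⟨q, rfl⟩ := hf h
    have : Finite (Shrink.{0} H) := Finite.of_equiv H (equivShrink.{0} H)
    have := hQ (Shrink.{0} H) ((Shrink.mulEquiv.{0} (α := H)).symm.toMonoidHom.comp f) q
    simpa using this
  exact ⟨fun a b ↦ (key a).trans (key b).symm⟩

theorem eq_top_of_finiteIndex (hQ : NoNontrivialFiniteQuotients Q) (K : Subgroup Q) [K.Normal]
    [K.FiniteIndex] : K = ⊤ := by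
  have := hQ.subsingleton_of_surjective (QuotientGroup.mk' K) (QuotientGroup.mk'_surjective K)
  exact QuotientGroup.subsingleton_iff.mp this

theorem map_eq_top_of_finiteIndex (hQ : NoNontrivialFiniteQuotients Q) {G : Type*} [Group G]
    (f : G →* Q) (hf : Function.Surjective f) (K : Subgroup G) [hK : K.Normal] [K.FiniteIndex] :
    K.map f = ⊤ := by
  have := hK.map f hf
  have : (K.map f).FiniteIndex :=
    ⟨ne_zero_of_dvd_ne_zero K.index_ne_zero_of_finite (K.index_map_dvd hf)⟩
  exact hQ.eq_top_of_finiteIndex _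

theorem of_surjective {A : Type*} [Group A] (hQ : NoNontrivialFiniteQuotients Q) (f : Q →* A)
    (hf : Function.Surjective f) :
    NoNontrivialFiniteQuotients A := by
  intro H _ _ g a
  obtain ⟨q, rfl⟩ := hf a
  exact hQ H (g.comp f) q

theorem subsingleton_of_comm {A : Type*} [CommGroup A] [Group.FG A]
    (hA : NoNontrivialFiniteQuotients A) : Subsingleton A := by
  have hsq : (powMonoidHom 2 : A →* A).range = ⊤ := by
    have : Finite (A ⧸ (powMonoidHom 2 : A →* A).range) := by
      apply CommGroup.finite_of_fg_isMulTorsion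
      intro x
      obtain ⟨a, rfl⟩ := QuotientGroup.mk_surjective x
      refine isOfFinOrder_iff_pow_eq_one.mpr ⟨2, two_pos, ?_⟩
      rw [← QuotientGroup.mk_pow, QuotientGroup.eq_one_iff]
      exact ⟨a, rfl⟩
    have : (powMonoidHom 2 : A →* A).range.FiniteIndex :=
      Subgroup.finiteIndex_of_finite_quotient
    exact hA.eq_top_of_finiteIndex _
  have hfin : Module.Finite ℤ (Additive A) :=
    Module.Finite.iff_addGroup_fg.mpr inferInstance
  obtain ⟨r, hr, hrA⟩ := Submodule.exists_sub_one_mem_and_smul_eq_zero_of_fg_of_le_smul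
    (Ideal.span {(2 : ℤ)}) (⊤ : Submodule ℤ (Additive A)) hfin.fg_top (by
      rintro x -
      obtain ⟨y, hy⟩ : x.toMul ∈ (powMonoidHom 2 : A →* A).range := hsq ▸ Subgroup.mem_top _
      have : x = (2 : ℤ) • Additive.ofMul y := by
        apply Additive.toMul.injective
        simpa using hy.symm
      rw [this]
      exact Submodule.smul_mem_smul (Ideal.mem_span_singleton_self _) trivial)
  have hr0 : r ≠ 0 := by
    rintro rfl
    rw [Ideal.mem_span_singleton] at hr
    omega
  have : Finite A := by
    apply CommGroup.finite_of_fg_isMulTorsion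
    intro a
    refine isOfFinOrder_iff_zpow_eq_one.mpr ⟨r, hr0, ?_⟩
    exact congrArg Additive.toMul (hrA (Additive.ofMul a) trivial)
  exact hA.subsingleton_of_surjective (MonoidHom.id A) Function.surjective_id

theorem commutator_eq_top [Group.FG Q] (hQ : NoNontrivialFiniteQuotients Q) : commutator Q = ⊤ := by
  have : Group.FG (Abelianization Q) := QuotientGroup.fg (commutator Q)
  have := (hQ.of_surjective (A := Abelianization Q) Abelianization.of
    (QuotientGroup.mk'_surjective _)).subsingleton_of_comm
  exact QuotientGroup.subsingleton_iff.mp this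

end NoNontrivialFiniteQuotients

section CentralExtensions

open scoped commutatorElement

/-- Multiplying by central elements does not change a commutator. -/
theorem commutatorElement_mul_mul_of_mem_center {C : Type*} [Group C] (a b : C) {z w : C}
    (hz : z ∈ Subgroup.center C) (hw : w ∈ Subgroup.center C) : ⁅a * z, b * w⁆ = ⁅a, b⁆ := by
  rw [Subgroup.mem_center_iff] at hz hw
  simp only [commutatorElement_def, mul_inv_rev]
  calc a * z * (b * w) * (z⁻¹ * a⁻¹) * (w⁻¹ * b⁻¹)
      = a * (z * (b * w)) * z⁻¹ * a⁻¹ * w⁻¹ * b⁻¹ := by group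
    _ = a * (b * w * a⁻¹) * w⁻¹ * b⁻¹ := by rw [← hz]; group
    _ = a * b * (w * a⁻¹) * w⁻¹ * b⁻¹ := by group
    _ = a * b * a⁻¹ * b⁻¹ := by rw [← hw]; group

/-- A central extension of a group with trivial `H2` has no nontrivial central kernel elements
in its commutator subgroup. -/
theorem commutator_inf_ker_eq_bot_of_subsingleton_H2 {C Q : Type*} [Group C] [Group Q]
    [hH2 : Subsingleton (H2 Q)] (π : C →* Q) (hπ : Function.Surjective π)
    (hc : π.ker ≤ Subgroup.center C) : commutator C ⊓ π.ker = ⊥ := by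
  let φ : FreeGroup Q →* C := FreeGroup.lift (Function.surjInv hπ)
  have hφ : π.comp φ = FreeGroup.lift id := by
    ext q
    simp [φ, Function.surjInv_eq hπ]
  have hker : ∀ c : C, (φ (FreeGroup.of (π c)))⁻¹ * c ∈ π.ker := by
    intro c
    simp [φ, MonoidHom.mem_ker, Function.surjInv_eq hπ]
  have hle : commutator C ≤ (commutator (FreeGroup Q)).map φ := by
    rw [commutator_def, Subgroup.commutator_le]
    intro a _ b _
    rw [← mul_inv_cancel_left (φ (FreeGroup.of (π a))) a,
      ← mul_inv_cancel_left (φ (FreeGroup.of (π b))) b,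
      commutatorElement_mul_mul_of_mem_center _ _ (hc (hker a)) (hc (hker b)),
      ← map_commutatorElement]
    exact Subgroup.mem_map_of_mem _
      (Subgroup.commutator_mem_commutator (Subgroup.mem_top _) (Subgroup.mem_top _))
  have hR : ⁅(⊤ : Subgroup (FreeGroup Q)), (FreeGroup.lift (id : Q → Q)).ker⁆ ≤ φ.ker := by
    rw [Subgroup.commutator_le]
    intro a _ b hb
    have hb' : φ b ∈ π.ker := by
      rw [← hφ] at hb
      exact hb
    rw [MonoidHom.mem_ker, map_commutatorElement, commutatorElement_eq_one_iff_mul_comm]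
    exact Subgroup.mem_center_iff.mp (hc hb') _
  have hHopf := QuotientGroup.subsingleton_iff.mp hH2
  rw [Subgroup.subgroupOf_eq_top] at hHopf
  rw [eq_bot_iff]
  rintro x ⟨hx, hxπ⟩
  obtain ⟨y, hy, rfl⟩ := hle hx
  refine hR (hHopf ⟨?_, hy⟩)
  rw [← hφ]
  exact hxπ

theorem exists_normal_finiteIndex_inf_ker_eq_bot {E Q : Type*} [Group E] [Group Q] [Group.FG Q]
    (hQ : NoNontrivialFiniteQuotients Q) [Subsingleton (H2 Q)] (π : E →* Q)
    (hπ : Function.Surjective π) [Finite π.ker] :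
    ∃ L : Subgroup E, L.Normal ∧ L.FiniteIndex ∧ L ⊓ π.ker = ⊥ := by
  let C : Subgroup E := (MulAut.conjNormal (H := π.ker)).ker
  have hCfin : C.FiniteIndex := Subgroup.finiteIndex_ker _
  have hCmap : C.map π = ⊤ := hQ.map_eq_top_of_finiteIndex π hπ C
  have hcomm : ∀ c ∈ C, ∀ b ∈ π.ker, c * b = b * c := by
    intro c hc b hb
    have := congrArg Subtype.val (DFunLike.congr_fun (MonoidHom.mem_ker.mp hc) ⟨b, hb⟩)
    rw [MulAut.conjNormal_apply] at this
    exact mul_inv_eq_iff_eq_mul.mp this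
  have hbot : commutator C ⊓ (π.comp C.subtype).ker = ⊥ := by
    apply commutator_inf_ker_eq_bot_of_subsingleton_H2
    · rw [← MonoidHom.range_eq_top, MonoidHom.range_comp, Subgroup.range_subtype, hCmap]
    · intro b hb
      exact Subgroup.mem_center_iff.mpr fun c ↦ Subtype.ext (hcomm c c.2 b hb)
  have hLmap : (⁅C, C⁆ : Subgroup E).map π = ⊤ := by
    rw [Subgroup.map_commutator, hCmap]
    exact hQ.commutator_eq_top
  refine ⟨⁅C, C⁆, inferInstance, ?_, ?_⟩
  · have hsurj : Function.Surjective ((QuotientGroup.mk' ⁅C, C⁆).comp π.ker.subtype) := by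
      intro x
      obtain ⟨e, rfl⟩ := QuotientGroup.mk'_surjective _ x
      obtain ⟨l, hl, hle⟩ : π e ∈ (⁅C, C⁆ : Subgroup E).map π := hLmap ▸ Subgroup.mem_top _
      refine ⟨⟨e * l⁻¹, by simp [MonoidHom.mem_ker, hle]⟩, ?_⟩
      simpa using hl
    have := Finite.of_surjective _ hsurj
    exact Subgroup.finiteIndex_of_finite_quotient
  · rw [eq_bot_iff]
    rintro x ⟨hx, hxπ⟩
    rw [← Subgroup.map_subtype_commutator] at hx
    obtain ⟨y, hy, rfl⟩ := hx
    have : y ∈ commutator C ⊓ (π.comp C.subtype).ker := ⟨hy, hxπ⟩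
    rw [hbot, Subgroup.mem_bot] at this
    simp [this]

theorem exists_normal_finiteIndex_inf_le {G : Type*} [Group G] [Group.FG G] (N : Subgroup G)
    [N.Normal] (hQ : NoNontrivialFiniteQuotients (G ⧸ N)) [Subsingleton (H2 (G ⧸ N))]
    (M : Subgroup G) [M.Normal] (hMN : M ≤ N) (hM : M.relIndex N ≠ 0) :
    ∃ L : Subgroup G, L.Normal ∧ L.FiniteIndex ∧ L ⊓ N ≤ M := by
  let π : G ⧸ M →* G ⧸ N := QuotientGroup.map M N (MonoidHom.id G) hMN
  have hπ : Function.Surjective π := by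
    intro x
    obtain ⟨g, rfl⟩ := QuotientGroup.mk_surjective x
    exact ⟨g, rfl⟩
  have hker : ∀ g : G, (g : G ⧸ M) ∈ π.ker ↔ g ∈ N := by
    intro g
    exact QuotientGroup.eq_one_iff g
  have : Finite π.ker := by
    have : (M.subgroupOf N).FiniteIndex := ⟨hM⟩
    let f : N →* π.ker := ((QuotientGroup.mk' M).comp N.subtype).codRestrict π.ker
      fun n ↦ (hker n).mpr n.2
    have hf : Function.Surjective f := by
      rintro ⟨x, hx⟩
      obtain ⟨g, rfl⟩ := QuotientGroup.mk_surjective x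
      exact ⟨⟨g, (hker g).mp hx⟩, rfl⟩
    have hfker : M.subgroupOf N ≤ f.ker := by
      intro n hn
      exact Subtype.ext ((QuotientGroup.eq_one_iff (n : G)).mpr hn)
    exact Finite.of_surjective (QuotientGroup.lift _ f hfker)
      (QuotientGroup.lift_surjective_of_surjective _ f hf hfker)
  obtain ⟨L, hLn, hLf, hL⟩ := exists_normal_finiteIndex_inf_ker_eq_bot hQ π hπ
  refine ⟨L.comap (QuotientGroup.mk' M), inferInstance, hLf.comap _, ?_⟩
  rintro x ⟨hxL, hxN⟩
  have : (x : G ⧸ M) ∈ L ⊓ π.ker := ⟨hxL, (hker x).mpr hxN⟩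
  rw [hL, Subgroup.mem_bot] at this
  exact (QuotientGroup.eq_one_iff x).mp this

end CentralExtensions

section FiberProduct

theorem profiniteSurj_fiberProduct {G Q : Type*} [Group G] [Group Q] (p : G →* Q)
    (hp : Function.Surjective p) (hQ : NoNontrivialFiniteQuotients Q) :
    ProfiniteSurj (fiberProduct p) := by
  intro H _ _ f hf
  have key : ∀ φ : G →* H, ∀ g : G, ∃ n ∈ p.ker, φ n = φ g := by
    intro φ g
    have hmap := hQ.map_eq_top_of_finiteIndex p hp φ.ker
    obtain ⟨k, hk, hkg⟩ : p g ∈ φ.ker.map p := hmap ▸ Subgroup.mem_top _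
    rw [SetLike.mem_coe, MonoidHom.mem_ker] at hk
    exact ⟨g * k⁻¹, by simp [MonoidHom.mem_ker, hkg], by simp [hk]⟩
  intro h
  obtain ⟨⟨a, b⟩, rfl⟩ := hf h
  obtain ⟨n, hn, hna⟩ := key (f.comp (MonoidHom.inl G G)) a
  obtain ⟨m, hm, hmb⟩ := key (f.comp (MonoidHom.inr G G)) b
  refine ⟨⟨(n, m), (MonoidHom.mem_ker.mp hn).trans (MonoidHom.mem_ker.mp hm).symm⟩, ?_⟩
  have hsplit : ∀ x y : G, f (x, y) = f (x, 1) * f (1, y) := by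
    intro x y
    rw [← map_mul]
    simp
  have hna' : f (n, 1) = f (a, 1) := hna
  have hmb' : f (1, m) = f (1, b) := hmb
  change f (n, m) = f (a, b)
  rw [hsplit, hna', hmb', ← hsplit]

theorem profiniteInj_fiberProduct_mk' {G : Type*} [Group G] [Group.FG G] (N : Subgroup G)
    [N.Normal] (hQ : NoNontrivialFiniteQuotients (G ⧸ N)) [Subsingleton (H2 (G ⧸ N))] :
    ProfiniteInj (fiberProduct (QuotientGroup.mk' N)) := by
  intro M hMn hMf
  let δ : G →* fiberProduct (QuotientGroup.mk' N) :=
    ((MonoidHom.id G).prod (MonoidHom.id G)).codRestrict _ fun _ ↦ rfl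
  let ι : N →* fiberProduct (QuotientGroup.mk' N) :=
    ((MonoidHom.inl G G).comp N.subtype).codRestrict _ fun n ↦ by
      change (QuotientGroup.mk' N) n = QuotientGroup.mk' N 1
      simp
  let M₁ : Subgroup G := (M.comap ι).map N.subtype
  have hM₁N : M₁ ≤ N := Subgroup.map_subtype_le _
  have hM₁ : M₁.subgroupOf N = M.comap ι :=
    Subgroup.comap_map_eq_self_of_injective N.subtype_injective _
  have hM₁rel : M₁.relIndex N ≠ 0 := by
    rw [Subgroup.relIndex, hM₁]
    exact (hMf.comap ι).index_ne_zero
  have : M₁.Normal := by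
    constructor
    rintro _ ⟨n, hn, rfl⟩ g
    refine ⟨⟨g * n * g⁻¹, Subgroup.Normal.conj_mem inferInstance _ n.2 g⟩, ?_, rfl⟩
    have hconj : ι ⟨g * n * g⁻¹, Subgroup.Normal.conj_mem inferInstance _ n.2 g⟩ =
        δ g * ι n * (δ g)⁻¹ := by
      apply Subtype.ext
      change (g * n * g⁻¹, (1 : G)) = (g * n * g⁻¹, g * 1 * g⁻¹)
      simp
    change ι _ ∈ M
    rw [hconj]
    exact hMn.conj_mem _ hn (δ g)
  obtain ⟨L, hLn, hLf, hL⟩ := exists_normal_finiteIndex_inf_le N hQ M₁ hM₁N hM₁rel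
  let K : Subgroup G := L ⊓ M.comap δ
  have := hMf.comap δ
  have : K.FiniteIndex := inferInstance
  have : K.Normal := inferInstance
  refine ⟨K.prod K, inferInstance, ?_, ?_⟩
  · constructor
    rw [Subgroup.index_prod]
    exact mul_ne_zero Subgroup.index_ne_zero_of_finite Subgroup.index_ne_zero_of_finite
  rintro ⟨⟨a, b⟩, hab⟩ ⟨ha, hb⟩
  have hN : a * b⁻¹ ∈ N := by
    rw [← QuotientGroup.eq_one_iff, QuotientGroup.mk_mul, QuotientGroup.mk_inv]
    exact mul_inv_eq_one.mpr hab
  obtain ⟨n, hn, hnab⟩ : a * b⁻¹ ∈ M₁ := hL ⟨L.mul_mem ha.1 (L.inv_mem hb.1), hN⟩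
  have hmul : (⟨(a, b), hab⟩ : fiberProduct (QuotientGroup.mk' N)) = ι n * δ b := by
    apply Subtype.ext
    change (a, b) = ((n : G) * b, 1 * b)
    rw [show (n : G) = a * b⁻¹ from hnab]
    simp
  rw [hmul]
  exact M.mul_mem hn hb.2

end FiberProduct

/-- **Corollary 0.2.** If `Q = G ⧸ N` has no nontrivial finite quotients and
`H₂(Q;ℤ) = 0`, then the inclusion of the fibre product `P ↪ G × G` induces an
isomorphism of profinite completions. -/
theorem fiberProduct_profinite_iso_of_no_finite_quotients_of_H2_trivial
    (G : Type*) [Group G] [Group.FG G] (N : Subgroup G) [N.Normal]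
    (h1 : NoNontrivialFiniteQuotients (G ⧸ N)) (h2 : Subsingleton (H2 (G ⧸ N))) :
    ProfiniteSurj (fiberProduct (QuotientGroup.mk' N)) ∧
      ProfiniteInj (fiberProduct (QuotientGroup.mk' N)) := by
  exact ⟨profiniteSurj_fiberProduct _ (QuotientGroup.mk'_surjective N) h1,
    profiniteInj_fiberProduct_mk' N h1⟩
end

section
/- Let Q be a finitely presented group with no nontrivial finite quotients and with H₂(Q;ℤ) ≠ 0. Then there exist a finitely generated free group F and a normal subgroup N of F with F/N isomorphic to Q such that the map of profinite completions induced by the inclusion N ↪ F is not injective; that is, there is a finite-index normal subgroup M of N such that no finite-index normal subgroup L of F satisfies L ∩ N ≤ M. -/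
/-- A finitely generated commutative group is residually finite. -/
theorem exists_finiteIndex_notMem_of_fg {A : Type*} [CommGroup A] [Group.FG A] {x : A}
    (hx : x ≠ 1) : ∃ M : Subgroup A, M.FiniteIndex ∧ x ∉ M := by
  obtain ⟨ι, j, _, _, p, hp, e, ⟨φ⟩⟩ := CommGroup.equiv_free_prod_prod_multiplicative_zmod A
  have hφ : φ x ≠ 1 := by simpa using hx
  by_cases h1 : (φ x).1 = 1
  · have h2 : (φ x).2 ≠ 1 := fun h => hφ (Prod.ext h1 h)
    have : ∀ i, NeZero (p i ^ e i) := fun i => ⟨pow_ne_zero _ (hp i).ne_zero⟩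
    have : ∀ i, Finite (Multiplicative (ZMod (p i ^ e i))) := fun i =>
      inferInstanceAs (Finite (ZMod (p i ^ e i)))
    exact ⟨((MonoidHom.snd _ _).comp φ.toMonoidHom).ker, Subgroup.finiteIndex_ker _, h2⟩
  · obtain ⟨i, hi⟩ := Function.ne_iff.mp h1
    set m : ℤ := Multiplicative.toAdd ((φ x).1 i) with hm
    have hm0 : m ≠ 0 := hi
    have : NeZero (m.natAbs + 1) := ⟨by omega⟩
    have : Finite (Multiplicative (ZMod (m.natAbs + 1))) :=
      inferInstanceAs (Finite (ZMod (m.natAbs + 1)))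
    refine ⟨((AddMonoidHom.toMultiplicative (Int.castAddHom (ZMod (m.natAbs + 1)))).comp
      ((Pi.evalMonoidHom _ i).comp ((MonoidHom.fst _ _).comp φ.toMonoidHom))).ker,
      Subgroup.finiteIndex_ker _, fun h => hm0 ?_⟩
    have h' : ((m : ℤ) : ZMod (m.natAbs + 1)) = 0 := h
    rw [ZMod.intCast_zmod_eq_zero_iff_dvd] at h'
    exact Int.eq_zero_of_abs_lt_dvd h' (by push_cast; omega)

open scoped commutatorElement in
/-- Two homomorphisms that differ by central elements agree on the commutator subgroup. -/
theorem MonoidHom.eq_of_mem_commutator_of_central {G H : Type*} [Group G] [Group H]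
    (f g : G →* H) (h : ∀ x, (f x)⁻¹ * g x ∈ Subgroup.center H) {x : G}
    (hx : x ∈ commutator G) : f x = g x := by
  have : commutator G ≤ f.eqLocus g := by
    rw [commutator_def, Subgroup.commutator_le]
    intro a _ b _
    change f ⁅a, b⁆ = g ⁅a, b⁆
    obtain ⟨z, hz⟩ : ∃ z, z = (f a)⁻¹ * g a := ⟨_, rfl⟩
    obtain ⟨w, hw⟩ : ∃ w, w = (f b)⁻¹ * g b := ⟨_, rfl⟩
    have hzc := Subgroup.mem_center_iff.mp (hz ▸ h a)
    have hwc := Subgroup.mem_center_iff.mp (hw ▸ h b)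
    have ha : g a = f a * z := by rw [hz]; group
    have hb : g b = f b * w := by rw [hw]; group
    rw [map_commutatorElement, map_commutatorElement, ha, hb, commutatorElement_def,
      commutatorElement_def]
    calc f a * f b * (f a)⁻¹ * (f b)⁻¹
        = f a * f b * ((f a)⁻¹ * (f b)⁻¹ * w) * w⁻¹ := by group
      _ = f a * f b * w * (f a)⁻¹ * (f b)⁻¹ * w⁻¹ := by
          rw [hwc ((f a)⁻¹ * (f b)⁻¹)]
          simp only [mul_assoc]
      _ = _ := by
          have e1 : (f b * w)⁻¹ = (f b)⁻¹ * w⁻¹ := by rw [hwc, mul_inv_rev]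
          have e2 : f a * z * (f b * w) * (f a * z)⁻¹ = f a * f b * w * (f a)⁻¹ := by
            rw [mul_assoc (f a) z, ← hzc (f b * w)]
            group
          rw [e1, e2]
          group
  exact this hx

/-- The image of `N` in `G ⧸ ⁅⊤, N⁆` is central. -/
theorem QuotientGroup.mk_mem_center_of_mem {G : Type*} [Group G] {N : Subgroup G} [N.Normal]
    {n : G} (hn : n ∈ N) :
    (QuotientGroup.mk' ⁅(⊤ : Subgroup G), N⁆ n) ∈
      Subgroup.center (G ⧸ ⁅(⊤ : Subgroup G), N⁆) := by
  rw [Subgroup.mem_center_iff]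
  intro g
  obtain ⟨g, rfl⟩ := QuotientGroup.mk'_surjective _ g
  rw [← commutatorElement_eq_one_iff_mul_comm, ← map_commutatorElement]
  exact (QuotientGroup.eq_one_iff _).mpr
    (Subgroup.commutator_mem_commutator (Subgroup.mem_top _) hn)

/-- The condition that the Hopf quotient `(N ∩ [F,F]) / [F,N]` vanishes passes from one free
presentation of `Q` to any other. -/
theorem ker_inf_commutator_le_of_surjective {α β Q : Type*} [Group Q] {p : FreeGroup α →* Q}
    {q : FreeGroup β →* Q} (hp : Function.Surjective p) (hq : Function.Surjective q)
    (h : p.ker ⊓ commutator (FreeGroup α) ≤ ⁅(⊤ : Subgroup (FreeGroup α)), p.ker⁆) :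
    q.ker ⊓ commutator (FreeGroup β) ≤ ⁅(⊤ : Subgroup (FreeGroup β)), q.ker⁆ := by
  let a : FreeGroup β →* FreeGroup α := FreeGroup.lift fun i => Function.surjInv hp (q (.of i))
  let b : FreeGroup α →* FreeGroup β := FreeGroup.lift fun i => Function.surjInv hq (p (.of i))
  have ha : p.comp a = q := by
    ext i; simp [a, Function.surjInv_eq hp]
  have hb : q.comp b = p := by
    ext i; simp [b, Function.surjInv_eq hq]
  have ha' (x) : p (a x) = q x := DFunLike.congr_fun ha x
  have hb' (x) : q (b x) = p x := DFunLike.congr_fun hb x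
  rintro x ⟨hxk, hxc⟩
  have hax : a x ∈ ⁅(⊤ : Subgroup (FreeGroup α)), p.ker⁆ := by
    refine h ⟨(ha' x).trans hxk, ?_⟩
    have : commutator (FreeGroup β) ≤ (commutator (FreeGroup α)).comap a := by
      rw [commutator_def, Subgroup.commutator_le]
      intro u _ v _
      rw [Subgroup.mem_comap, map_commutatorElement]
      exact Subgroup.commutator_mem_commutator (Subgroup.mem_top _) (Subgroup.mem_top _)
    exact this hxc
  have hbax : b (a x) ∈ ⁅(⊤ : Subgroup (FreeGroup β)), q.ker⁆ := by
    have : ⁅(⊤ : Subgroup (FreeGroup α)), p.ker⁆ ≤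
        (⁅(⊤ : Subgroup (FreeGroup β)), q.ker⁆).comap b := by
      rw [Subgroup.commutator_le]
      intro u _ v hv
      rw [Subgroup.mem_comap, map_commutatorElement]
      exact Subgroup.commutator_mem_commutator (Subgroup.mem_top _)
        (by rw [MonoidHom.mem_ker, hb']; exact hv)
    exact this hax
  let π := QuotientGroup.mk' ⁅(⊤ : Subgroup (FreeGroup β)), q.ker⁆
  have key : π x = (π.comp (b.comp a)) x := by
    refine MonoidHom.eq_of_mem_commutator_of_central _ _ (fun y => ?_) hxc
    rw [MonoidHom.comp_apply, ← map_inv, ← map_mul]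
    refine QuotientGroup.mk_mem_center_of_mem ?_
    rw [MonoidHom.mem_ker, map_mul, map_inv, MonoidHom.comp_apply, hb', ha', inv_mul_cancel]
  rw [← QuotientGroup.eq_one_iff]
  exact key.trans ((QuotientGroup.eq_one_iff _).mpr hbax)

/-- If `N` is the normal closure of a finite set, then `N / [G,N]` is residually finite. -/
theorem exists_finiteIndex_notMem_of_normalClosure {G : Type*} [Group G] {N : Subgroup G}
    [N.Normal] {R : Set G} (hR : R.Finite) (hN : N = Subgroup.normalClosure R) {x : G}
    (hx : x ∉ ⁅(⊤ : Subgroup G), N⁆) (hxN : x ∈ N) :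
    ∃ M : Subgroup N, M.Normal ∧ M.FiniteIndex ∧ ⁅(⊤ : Subgroup G), N⁆.subgroupOf N ≤ M ∧
      (⟨x, hxN⟩ : N) ∉ M := by
  let π := QuotientGroup.mk' ⁅(⊤ : Subgroup G), N⁆
  let B := Subgroup.closure (π '' R)
  have hBc : B ≤ Subgroup.center _ := by
    rw [Subgroup.closure_le]
    rintro _ ⟨r, hr, rfl⟩
    exact QuotientGroup.mk_mem_center_of_mem (hN ▸ Subgroup.subset_normalClosure hr)
  have hBn : B.Normal := ⟨fun b hb g => by
    rwa [Subgroup.mem_center_iff.mp (hBc hb) g, mul_inv_cancel_right]⟩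
  have hNB : N ≤ B.comap π := by
    conv_lhs => rw [hN]
    exact Subgroup.normalClosure_le_normal fun r hr =>
      Subgroup.subset_closure (Set.mem_image_of_mem π hr)
  let _ : CommGroup B := { (inferInstance : Group B) with
    mul_comm := fun u v => Subtype.ext (Subgroup.mem_center_iff.mp (hBc v.2) u) }
  have : Finite (π '' R) := hR.image π
  have : Group.FG B := Group.closure_finite_fg _
  let ψ : N →* B := (π.comp N.subtype).codRestrict B fun n => hNB n.2
  have hψ (n : N) : ψ n = 1 ↔ (n : G) ∈ ⁅(⊤ : Subgroup G), N⁆ := by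
    rw [← QuotientGroup.eq_one_iff, Subtype.ext_iff]
    rfl
  obtain ⟨M, hM, hxM⟩ := exists_finiteIndex_notMem_of_fg (x := ψ ⟨x, hxN⟩) fun h =>
    hx ((hψ _).mp h)
  refine ⟨M.comap ψ, inferInstance, ⟨?_⟩, fun n hn => ?_, hxM⟩
  · rw [Subgroup.index_comap]
    exact fun h => hM.index_ne_zero (Subgroup.index_eq_zero_of_relIndex_eq_zero h)
  rw [Subgroup.mem_comap, (hψ n).mpr hn]
  exact M.one_mem

/-- If `Q` has no nontrivial finite quotients, the kernel of a surjection onto `Q` together with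
any finite-index normal subgroup generates the whole group. -/
theorem NoNontrivialFiniteQuotients.sup_ker_eq_top {G : Type} {Q : Type*} [Group G] [Group Q]
    (hQ : NoNontrivialFiniteQuotients Q) {p : G →* Q} (hp : Function.Surjective p)
    (L : Subgroup G) [L.Normal] [L.FiniteIndex] : L ⊔ p.ker = ⊤ := by
  have : (L ⊔ p.ker).FiniteIndex := Subgroup.finiteIndex_of_le le_sup_left
  let π := QuotientGroup.mk' (L ⊔ p.ker)
  let f := p.liftOfSurjective hp ⟨π, by rw [QuotientGroup.ker_mk']; exact le_sup_right⟩
  rw [eq_top_iff]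
  intro g _
  rw [← QuotientGroup.eq_one_iff]
  have := hQ _ f (p g)
  rwa [MonoidHom.liftOfRightInverse_comp_apply] at this

open scoped commutatorElement in
/-- If `L` and `N` are normal and generate `G`, then `[G,G] ≤ L [G,N]`. -/
theorem commutator_le_sup_of_sup_eq_top {G : Type*} [Group G] {L N : Subgroup G} [L.Normal]
    [N.Normal] (h : L ⊔ N = ⊤) : commutator G ≤ L ⊔ ⁅(⊤ : Subgroup G), N⁆ := by
  rw [commutator_def, Subgroup.commutator_le]
  intro a _ b _
  obtain ⟨l, hl, n, hn, rfl⟩ := Subgroup.mem_sup_of_normal_left.mp (h ▸ Subgroup.mem_top b)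
  have hK : (⁅a, l * n⁆ : G) = ⁅a, l⁆ * (l * ⁅a, n⁆ * l⁻¹) := by
    simp only [commutatorElement_def]
    group
  rw [hK]
  refine Subgroup.mul_mem_sup (Subgroup.commutator_le_right _ _ <|
    Subgroup.commutator_mem_commutator (Subgroup.mem_top a) hl) ?_
  exact Subgroup.Normal.conj_mem inferInstance _
    (Subgroup.commutator_mem_commutator (Subgroup.mem_top a) hn) l

/-- **Proposition 1.1 (free case).** If `Q` is finitely presented, has no nontrivial
finite quotients, and `H₂(Q;ℤ) ≠ 0`, then there is a finitely generated free group `F`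
and a normal subgroup `N ◁ F` with `F ⧸ N ≅ Q` (i.e. `N = ker p` for a surjection
`p : F → Q`) such that the induced map of profinite completions `N̂ → F̂` is not
injective. -/
theorem exists_free_with_profinite_not_inj
    (Q : Type) [Group Q] (hfp : FinitelyPresentedGroup Q)
    (hnq : NoNontrivialFiniteQuotients Q) (hH2 : Nontrivial (H2 Q)) :
    ∃ (k : ℕ) (p : FreeGroup (Fin k) →* Q),
      Function.Surjective p ∧ ¬ ProfiniteInj p.ker := by
  obtain ⟨k, R, ⟨e⟩⟩ := hfp
  let p : FreeGroup (Fin k) →* Q := e.toMonoidHom.comp (PresentedGroup.mk _)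
  have hp : Function.Surjective p := e.surjective.comp (QuotientGroup.mk'_surjective _)
  have hker : p.ker = Subgroup.normalClosure (R : Set (FreeGroup (Fin k))) := by
    ext x
    rw [MonoidHom.mem_ker, ← QuotientGroup.eq_one_iff]
    exact e.map_eq_one_iff
  refine ⟨k, p, hp, fun hinj => ?_⟩
  have hne : ¬ p.ker ⊓ commutator _ ≤ ⁅(⊤ : Subgroup (FreeGroup (Fin k))), p.ker⁆ := by
    intro h
    have hq : Function.Surjective (FreeGroup.lift (id : Q → Q)) := fun x =>
      ⟨.of x, FreeGroup.lift_apply_of⟩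
    have := ker_inf_commutator_le_of_surjective hp hq h
    rw [← Subgroup.subgroupOf_eq_top] at this
    have hs : Subsingleton (H2 Q) := by
      unfold H2
      rw [this]
      exact QuotientGroup.subsingleton_quotient_top
    exact not_subsingleton _ hs
  obtain ⟨x, ⟨hxN, hxc⟩, hx⟩ := SetLike.not_le_iff_exists.mp hne
  obtain ⟨M, hMn, hMf, hCM, hxM⟩ :=
    exists_finiteIndex_notMem_of_normalClosure R.finite_toSet hker hx hxN
  obtain ⟨L, hLn, hLf, hLM⟩ := hinj M hMn hMf
  obtain ⟨l, hl, c, hc, hlc⟩ := Subgroup.mem_sup_of_normal_left.mp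
    (commutator_le_sup_of_sup_eq_top (hnq.sup_ker_eq_top hp L) hxc)
  have hcN : c ∈ p.ker := Subgroup.commutator_le_right _ _ hc
  have hlN : l ∈ p.ker := by
    rw [eq_mul_inv_of_mul_eq hlc]
    exact mul_mem hxN (inv_mem hcN)
  have hxlc : (⟨x, hxN⟩ : p.ker) = ⟨l, hlN⟩ * ⟨c, hcN⟩ := Subtype.ext hlc.symm
  rw [hxlc] at hxM
  exact hxM (mul_mem (hLM hl) (hCM hc))
end

section
/- Let Q be a finitely presented group with no nontrivial finite quotients and with H₂(Q;ℤ) ≠ 0. Then there exist a finitely presented, residually finite group G and a finitely generated normal subgroup N of G, with N residually finite, such that G/N is isomorphic to Q and the map of profinite completions induced by the inclusion N ↪ G is not injective; that is, there is a finite-index normal subgroup M of N such that no finite-index normal subgroup L of G satisfies L ∩ N ≤ M. -/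
section ResidualFiniteness

/-- Free groups are residually finite. -/
theorem residuallyFinite_freeGroup (α : Type) : ResiduallyFinite (FreeGroup α) := by
  classical
  intro g hg
  let S : Set (FreeGroup α) := {x | ∃ l, l <:+ g.toWord ∧ FreeGroup.mk l = x}
  have hfin : Finite S :=
    ((List.finite_toSet g.toWord.tails).image FreeGroup.mk).subset (by
      rintro _ ⟨l, hl, rfl⟩
      exact ⟨l, (List.mem_tails _ _).2 hl, rfl⟩)
  have : Fintype S := Fintype.ofFinite S
  let e (a : α) : {s : S // FreeGroup.of a * s.1 ∈ S} ≃ {s : S // (FreeGroup.of a)⁻¹ * s.1 ∈ S} :=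
    { toFun := fun s => ⟨⟨FreeGroup.of a * s.1.1, s.2⟩, by simp⟩
      invFun := fun s => ⟨⟨(FreeGroup.of a)⁻¹ * s.1.1, s.2⟩, by simp⟩
      left_inv := fun s => by simp
      right_inv := fun s => by simp }
  let σ (a : α) : Equiv.Perm S := (e a).extendSubtype
  have hσ (a : α) (s : S) (h : FreeGroup.of a * s.1 ∈ S) : σ a s = ⟨FreeGroup.of a * s.1, h⟩ :=
    (e a).extendSubtype_apply_of_mem s h
  have h1 : (1 : FreeGroup α) ∈ S := ⟨[], List.nil_suffix, rfl⟩
  have key : ∀ l (hl : l <:+ g.toWord),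
      FreeGroup.lift σ (FreeGroup.mk l) ⟨1, h1⟩ = ⟨FreeGroup.mk l, l, hl, rfl⟩ := by
    intro l
    induction l with
    | nil => intro _; rfl
    | cons x l ih =>
      intro hl
      have hl' : l <:+ g.toWord := (List.suffix_cons x l).trans hl
      obtain ⟨a, b⟩ := x
      have hmem : FreeGroup.mk ((a, b) :: l) ∈ S := ⟨_, hl, rfl⟩
      have hsplit : FreeGroup.mk ((a, b) :: l) = FreeGroup.mk [(a, b)] * FreeGroup.mk l := by
        simp [FreeGroup.mul_mk]
      rw [show FreeGroup.lift σ (FreeGroup.mk ((a, b) :: l)) =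
        FreeGroup.lift σ (FreeGroup.mk [(a, b)]) * FreeGroup.lift σ (FreeGroup.mk l) by
          rw [hsplit, map_mul], Equiv.Perm.mul_apply, ih hl']
      cases b with
      | true =>
        have hof : FreeGroup.mk [(a, true)] = FreeGroup.of a := rfl
        rw [hof, FreeGroup.lift_apply_of]
        rw [hof] at hsplit
        rw [hσ a _ (hsplit ▸ hmem)]
        exact Subtype.ext hsplit.symm
      | false =>
        have hof : FreeGroup.mk [(a, false)] = (FreeGroup.of a)⁻¹ := rfl
        rw [hof, map_inv, FreeGroup.lift_apply_of, Equiv.Perm.inv_eq_iff_eq]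
        rw [hof] at hsplit
        have hcancel : FreeGroup.of a * FreeGroup.mk ((a, false) :: l) = FreeGroup.mk l := by
          rw [hsplit, mul_inv_cancel_left]
        rw [hσ a ⟨_, hmem⟩ (hcancel ▸ ⟨l, hl', rfl⟩)]
        exact Subtype.ext hcancel.symm
  refine ⟨Equiv.Perm S, inferInstance, inferInstance, FreeGroup.lift σ, fun h => hg ?_⟩
  have := congrArg Subtype.val (key g.toWord (List.suffix_refl _))
  simp only [FreeGroup.mk_toWord, h] at this
  exact this.symm

theorem ResiduallyFinite.subgroup {G : Type*} [Group G] (hG : ResiduallyFinite G)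
    (K : Subgroup G) : ResiduallyFinite K := by
  intro g hg
  obtain ⟨H, _, _, f, hf⟩ := hG g (by simpa using hg)
  exact ⟨H, _, ‹_›, f.comp K.subtype, hf⟩

/-- **Malcev**: a split extension of a finitely generated residually finite group by a residually
finite group is residually finite. Finite generation enters only through the finiteness of the set
of homomorphisms to a finite group. -/
theorem ResiduallyFinite.semidirectProduct {N H : Type} [Group N] [Group H] (θ : H →* MulAut N)
    (hfin : ∀ (D : Type) [Group D] [Finite D], Finite (N →* D))
    (hN : ResiduallyFinite N) (hH : ResiduallyFinite H) : ResiduallyFinite (N ⋊[θ] H) := by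
  intro g hg
  by_cases hr : g.right = 1
  · have hl : g.left ≠ 1 := fun hl => hg (SemidirectProduct.ext hl hr)
    obtain ⟨D, _, _, f, hf⟩ := hN g.left hl
    have := hfin D
    let fn : N →* Equiv.Perm ((N →* D) × D) :=
      { toFun := fun n => Equiv.prodShear (Equiv.refl _) fun φ => Equiv.mulLeft (φ n)
        map_one' := by ext x <;> simp
        map_mul' := fun a b => Equiv.ext fun x => Prod.ext rfl (by simp) }
    let fg : H →* Equiv.Perm ((N →* D) × D) :=
      { toFun := fun h =>
          { toFun := fun x => (x.1.comp (θ h⁻¹).toMonoidHom, x.2)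
            invFun := fun x => (x.1.comp (θ h).toMonoidHom, x.2)
            left_inv := fun x => by ext <;> simp
            right_inv := fun x => by ext <;> simp }
        map_one' := by ext x <;> simp
        map_mul' := fun a b => by ext x <;> simp }
    refine ⟨Equiv.Perm ((N →* D) × D), inferInstance, inferInstance,
      SemidirectProduct.lift fn fg fun h => ?_, fun h => hf ?_⟩
    · refine MonoidHom.ext fun n => eq_mul_inv_of_mul_eq (Equiv.ext ?_)
      rintro ⟨φ, d⟩
      have hφ : φ (θ h⁻¹ (θ h n)) = φ n := by simp
      exact Prod.ext rfl (congrArg (· * d) hφ)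
    · rw [← SemidirectProduct.inl_left_mul_inr_right g, hr, map_one, mul_one,
        SemidirectProduct.lift_inl] at h
      have := congrArg Prod.snd (Equiv.congr_fun h (f, 1))
      exact (mul_one _).symm.trans this
  · obtain ⟨D, _, _, f, hf⟩ := hH g.right hr
    exact ⟨D, _, ‹_›, f.comp SemidirectProduct.rightHom, hf⟩

/-- Finitely generated abelian groups are residually finite. -/
theorem residuallyFinite_of_commGroup_fg (A : Type) [CommGroup A] [Group.FG A] :
    ResiduallyFinite A := by
  obtain ⟨ι, j, _, _, p, hp, e, ⟨φ⟩⟩ := CommGroup.equiv_free_prod_prod_multiplicative_zmod A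
  intro g hg
  have : φ g ≠ 1 := by simpa using hg
  by_cases h1 : (φ g).1 = 1
  · have h2 : (φ g).2 ≠ 1 := fun h2 => this (Prod.ext h1 h2)
    have (i : ι) : NeZero (p i ^ e i) := ⟨pow_ne_zero _ (hp i).ne_zero⟩
    exact ⟨_, inferInstance, inferInstance, (MonoidHom.snd _ _).comp φ.toMonoidHom, h2⟩
  · obtain ⟨i, hi⟩ := Function.ne_iff.1 h1
    set n : ℤ := Multiplicative.toAdd ((φ g).1 i) with hn
    have hn0 : n ≠ 0 := hi
    refine ⟨Multiplicative (ZMod (n.natAbs + 1)), inferInstance, inferInstance,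
      (AddMonoidHom.toMultiplicative (Int.castAddHom (ZMod (n.natAbs + 1)))).comp
        ((Pi.evalMonoidHom _ i).comp ((MonoidHom.fst _ _).comp φ.toMonoidHom)), fun h => hn0 ?_⟩
    have h' : ((n : ℤ) : ZMod (n.natAbs + 1)) = 0 := h
    rw [ZMod.intCast_zmod_eq_zero_iff_dvd] at h'
    refine Int.eq_zero_of_abs_lt_dvd h' ?_
    push_cast
    lia

end ResidualFiniteness

section FinitePresentation

theorem finitelyPresentedGroup_iff {G : Type*} [Group G] :
    FinitelyPresentedGroup G ↔ Group.IsFinitelyPresented G := by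
  constructor
  · rintro ⟨k, R, ⟨e⟩⟩
    refine ⟨k, e.toMonoidHom.comp (PresentedGroup.mk _),
      e.surjective.comp (PresentedGroup.mk_surjective _), R, R.finite_toSet, ?_⟩
    ext x
    simp [MonoidHom.mem_ker, PresentedGroup.mk_eq_one_iff]
  · intro h
    obtain ⟨n, s, hs, ⟨e⟩⟩ := Group.IsFinitelyPresented.exists_mulEquiv_presentedGroup (G := G)
    lift s to Finset (FreeGroup (Fin n)) using hs
    exact ⟨n, s, ⟨e.symm⟩⟩

/-- For an action of a free group, the compatibility needed for `SemidirectProduct.lift` may be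
checked on free generators. -/
theorem semidirectProduct_lift_compat_of_free {β N H : Type*} [Group N] [Group H]
    (θ : FreeGroup β →* MulAut N) (fn : N →* H) (fg : FreeGroup β →* H)
    (h : ∀ b n, fn (θ (.of b) n) = fg (.of b) * fn n * (fg (.of b))⁻¹) (g : FreeGroup β) :
    fn.comp (θ g).toMonoidHom = (MulAut.conj (fg g)).toMonoidHom.comp fn := by
  ext n
  simp only [MonoidHom.comp_apply, MulEquiv.coe_toMonoidHom, MulAut.conj_apply]
  induction g using FreeGroup.induction_on generalizing n with
  | C1 => simp
  | of b => exact h b n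
  | inv_of b _ =>
    have := h b ((θ (.of b))⁻¹ n)
    rw [MulAut.apply_inv_self] at this
    simp [this, mul_assoc]
  | mul x y hx hy => simp [hx, hy, mul_assoc]

theorem isFinitelyPresented_semidirectProduct_freeGroup {α β : Type*} [Finite α] [Finite β]
    (θ : FreeGroup β →* MulAut (FreeGroup α)) :
    Group.IsFinitelyPresented (FreeGroup α ⋊[θ] FreeGroup β) := by
  let rel (p : β × α) : FreeGroup (α ⊕ β) :=
    .of (.inr p.1) * .of (.inl p.2) * (.of (.inr p.1))⁻¹ *
      (FreeGroup.map Sum.inl (θ (.of p.1) (.of p.2)))⁻¹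
  let P := PresentedGroup (Set.range rel)
  let jα : FreeGroup α →* P := (PresentedGroup.mk _).comp (FreeGroup.map Sum.inl)
  let jβ : FreeGroup β →* P := (PresentedGroup.mk _).comp (FreeGroup.map Sum.inr)
  have hrel (b : β) : jα.comp (θ (.of b)).toMonoidHom =
      (MulAut.conj (jβ (.of b))).toMonoidHom.comp jα := by
    ext a
    have := PresentedGroup.one_of_mem (rels := Set.range rel) ⟨(b, a), rfl⟩
    simp only [rel, map_mul, map_inv] at this
    simpa [jα, jβ] using (mul_inv_eq_one.1 this).symm
  let inv : FreeGroup α ⋊[θ] FreeGroup β →* P := SemidirectProduct.lift jα jβ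
    (semidirectProduct_lift_compat_of_free θ jα jβ fun b n => DFunLike.congr_fun (hrel b) n)
  let gen : α ⊕ β → FreeGroup α ⋊[θ] FreeGroup β :=
    Sum.elim (fun a => .inl (.of a)) (fun b => .inr (.of b))
  have hinl : (FreeGroup.lift gen).comp (FreeGroup.map Sum.inl) = SemidirectProduct.inl := by
    ext1 a; simp [gen]
  have hinr : (FreeGroup.lift gen).comp (FreeGroup.map Sum.inr) = SemidirectProduct.inr := by
    ext1 b; simp [gen]
  let fwd : P →* FreeGroup α ⋊[θ] FreeGroup β := PresentedGroup.toGroup (f := gen) (by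
    rintro _ ⟨⟨b, a⟩, rfl⟩
    have := DFunLike.congr_fun hinl (θ (.of b) (.of a))
    rw [MonoidHom.comp_apply] at this
    simp only [rel, map_mul, map_inv, this, SemidirectProduct.inl_aut]
    simp [gen])
  refine Group.IsFinitelyPresented.equiv (MonoidHom.toMulEquiv fwd inv ?_ ?_)
  · ext x
    rw [MonoidHom.comp_apply, PresentedGroup.toGroup.of]
    rcases x with a | b
    · exact SemidirectProduct.lift_inl ..
    · exact SemidirectProduct.lift_inr ..
  · refine SemidirectProduct.hom_ext ?_ ?_
    · rw [MonoidHom.comp_assoc, SemidirectProduct.lift_comp_inl]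
      exact hinl
    · rw [MonoidHom.comp_assoc, SemidirectProduct.lift_comp_inr]
      exact hinr

end FinitePresentation
section RipsConstruction

variable {α : Type*}

/-- The endomorphism of `FreeGroup (Option α)` fixing the generators `some a` and sending the
generator `none` to `u * none * v⁻¹`, where `u` and `v` are words in the fixed generators. -/
def twistHom (u v : FreeGroup α) : FreeGroup (Option α) →* FreeGroup (Option α) :=
  FreeGroup.lift fun o => o.elim
    (FreeGroup.map some u * .of none * (FreeGroup.map some v)⁻¹) fun a => .of (some a)

theorem twistHom_none (u v : FreeGroup α) : twistHom u v (.of none) =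
    FreeGroup.map some u * .of none * (FreeGroup.map some v)⁻¹ := by
  simp [twistHom]

theorem twistHom_map_some (u v w : FreeGroup α) :
    twistHom u v (FreeGroup.map some w) = FreeGroup.map some w := by
  have : (twistHom u v).comp (FreeGroup.map some) = FreeGroup.map some := by
    ext1 a; simp [twistHom]
  exact DFunLike.congr_fun this w

theorem twistHom_comp_inv (u v : FreeGroup α) :
    (twistHom u v).comp (twistHom u⁻¹ v⁻¹) = MonoidHom.id _ := by
  ext1 o
  cases o with
  | none => simp [twistHom_none, twistHom_map_some, mul_assoc]
  | some a => simp [twistHom]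

/-- `twistHom` as an automorphism. -/
def twist (u v : FreeGroup α) : MulAut (FreeGroup (Option α)) :=
  MonoidHom.toMulEquiv (twistHom u v) (twistHom u⁻¹ v⁻¹)
    (by simpa using twistHom_comp_inv u⁻¹ v⁻¹) (twistHom_comp_inv u v)

theorem twist_apply (u v : FreeGroup α) (w : FreeGroup (Option α)) :
    twist u v w = twistHom u v w := rfl

variable {τ : Type*} (w : τ → FreeGroup α)

/-- The action of a free group on `FreeGroup (Option α)` by twists: the generator indexed by `a : α`
sends `none` to its conjugate by `a`, and the one indexed by `t : τ` sends it to `w t * none`. -/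
def ripsAction : FreeGroup (α ⊕ τ) →* MulAut (FreeGroup (Option α)) :=
  FreeGroup.lift (Sum.elim (fun a => twist (.of a) (.of a)) fun t => twist (w t) 1)

theorem ripsAction_map_some (h : FreeGroup (α ⊕ τ)) (u : FreeGroup α) :
    ripsAction w h (FreeGroup.map some u) = FreeGroup.map some u := by
  induction h using FreeGroup.induction_on with
  | C1 => simp
  | of x => rcases x with a | t <;> simp [ripsAction, twist_apply, twistHom_map_some]
  | inv_of x hx => rw [map_inv, MulAut.inv_apply, MulEquiv.symm_apply_eq, hx]
  | mul x y hx hy => rw [map_mul, MulAut.mul_apply, hy, hx]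

/-- A free-by-free group mapping onto the group presented by generators `α` and relators `w`, with
finitely generated kernel. -/
abbrev RipsGroup := FreeGroup (Option α) ⋊[ripsAction w] FreeGroup (α ⊕ τ)

namespace RipsGroup

/-- The projection from `FreeGroup (Option α)` killing the generator `none`. -/
def retract (α : Type*) : FreeGroup (Option α) →* FreeGroup α :=
  FreeGroup.lift fun o => o.elim 1 .of

theorem retract_map_some (u : FreeGroup α) : retract α (FreeGroup.map some u) = u := by
  have : (retract α).comp (FreeGroup.map some) = MonoidHom.id _ := by
    ext1 a; simp [retract]
  exact DFunLike.congr_fun this u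

/-- The inclusion of the free group on `α`. -/
def base : FreeGroup α →* RipsGroup w := SemidirectProduct.inl.comp (FreeGroup.map some)

/-- The generators of the kernel. -/
def kerGen : Option (α ⊕ τ) → RipsGroup w
  | none => .inl (.of none)
  | some x => .inr (.of x)

/-- The subgroup generated by all generators outside `α`. -/
def fiber : Subgroup (RipsGroup w) := Subgroup.closure (Set.range (kerGen w))

theorem none_mem_fiber : SemidirectProduct.inl (.of none) ∈ fiber w :=
  Subgroup.subset_closure ⟨none, rfl⟩

theorem inr_mem_fiber (h : FreeGroup (α ⊕ τ)) : SemidirectProduct.inr h ∈ fiber w := by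
  induction h using FreeGroup.induction_on with
  | C1 => simp
  | of x => exact Subgroup.subset_closure ⟨some x, rfl⟩
  | inv_of x hx => simpa using hx
  | mul x y hx hy => simpa using mul_mem hx hy

theorem base_commute_inr (u : FreeGroup α) (h : FreeGroup (α ⊕ τ)) :
    Commute (base w u) (SemidirectProduct.inr h) := by
  have := SemidirectProduct.inl_aut (φ := ripsAction w) h (FreeGroup.map some u)
  rw [ripsAction_map_some, map_inv] at this
  exact eq_mul_inv_iff_mul_eq.1 this

theorem base_mem_fiber (t : τ) : base w (w t) ∈ fiber w := by
  have := SemidirectProduct.inl_aut (φ := ripsAction w) (.of (.inr t)) (.of none)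
  have h : ripsAction w (.of (.inr t)) (.of none) = FreeGroup.map some (w t) * .of none := by
    simp [ripsAction, twist_apply, twistHom_none]
  rw [h, map_mul, map_inv] at this
  change base w (w t) * _ = _ at this
  rw [eq_mul_inv_of_mul_eq this]
  exact mul_mem (mul_mem (mul_mem (inr_mem_fiber w _) (none_mem_fiber w))
    (inv_mem (inr_mem_fiber w _))) (inv_mem (none_mem_fiber w))

theorem base_of_conj_none (a : α) :
    base w (.of a) * .inl (.of none) * (base w (.of a))⁻¹ =
      .inr (.of (.inl a)) * .inl (.of none) * (.inr (.of (.inl a)))⁻¹ := by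
  have := SemidirectProduct.inl_aut (φ := ripsAction w) (.of (.inl a)) (.of none)
  rw [map_inv] at this
  have h : ripsAction w (.of (.inl a)) (.of none) =
      FreeGroup.map some (.of a) * .of none * (FreeGroup.map some (.of a))⁻¹ := by
    simp [ripsAction, twist_apply, twistHom_none]
  rw [← this, h, map_mul, map_mul, map_inv]
  rfl

theorem base_of_inv_conj_none (a : α) :
    (base w (.of a))⁻¹ * .inl (.of none) * base w (.of a) =
      (.inr (.of (.inl a)))⁻¹ * .inl (.of none) * .inr (.of (.inl a)) := by
  have h := base_of_conj_none w a
  have hc := base_commute_inr w (.of a) (.of (.inl a))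
  generalize base w (.of a) = x at *
  generalize (SemidirectProduct.inr (.of (.inl a)) : RipsGroup w) = y at *
  generalize (SemidirectProduct.inl (.of none) : RipsGroup w) = b at *
  have hb : b = x * (y⁻¹ * b * y) * x⁻¹ := by
    calc b = y⁻¹ * (y * b * y⁻¹) * y := by group
      _ = y⁻¹ * x * b * (x⁻¹ * y) := by rw [← h]; group
      _ = x * y⁻¹ * b * (y * x⁻¹) := by rw [hc.inv_right.eq, hc.inv_left.eq]
      _ = _ := by group
  conv_lhs => rw [hb]
  group

theorem conj_mem_fiber_of_kerGen {g : RipsGroup w}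
    (h : ∀ x, g * kerGen w x * g⁻¹ ∈ fiber w) {n : RipsGroup w} (hn : n ∈ fiber w) :
    g * n * g⁻¹ ∈ fiber w := by
  have : fiber w ≤ (fiber w).comap (MulAut.conj g).toMonoidHom := by
    refine (Subgroup.closure_le _).2 ?_
    rintro _ ⟨x, rfl⟩
    exact h x
  exact this hn

theorem fiber_normal : (fiber w).Normal := by
  refine ⟨fun n hn g => ?_⟩
  rw [← SemidirectProduct.inl_left_mul_inr_right g]
  have hr := mul_mem (mul_mem (inr_mem_fiber w g.right) hn) (inv_mem (inr_mem_fiber w g.right))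
  rw [mul_inv_rev, mul_assoc, mul_assoc, ← mul_assoc _ n, ← mul_assoc _ _ (_)⁻¹, ← mul_assoc]
  generalize SemidirectProduct.inr g.right * n * (SemidirectProduct.inr g.right)⁻¹ = m at *
  clear hn
  generalize g.left = v
  induction v using FreeGroup.induction_on generalizing m with
  | C1 => simpa
  | of o =>
    cases o with
    | none => exact mul_mem (mul_mem (none_mem_fiber w) hr) (inv_mem (none_mem_fiber w))
    | some a =>
      refine conj_mem_fiber_of_kerGen w (fun x => ?_) hr
      have ha : SemidirectProduct.inl (.of (some a)) = base w (.of a) := by simp [base]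
      rw [ha]
      cases x with
      | none =>
        exact (base_of_conj_none w a).symm ▸ mul_mem (mul_mem (inr_mem_fiber w _)
          (none_mem_fiber w)) (inv_mem (inr_mem_fiber w _))
      | some x =>
        change base w _ * .inr _ * _ ∈ _
        rw [(base_commute_inr w _ _).eq, mul_inv_cancel_right]
        exact inr_mem_fiber w _
  | inv_of o =>
    cases o with
    | none =>
      rw [map_inv]
      exact mul_mem (mul_mem (inv_mem (none_mem_fiber w)) hr) (inv_mem (inv_mem (none_mem_fiber w)))
    | some a =>
      refine conj_mem_fiber_of_kerGen w (fun x => ?_) hr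
      have ha : SemidirectProduct.inl (.of (some a)) = base w (.of a) := by simp [base]
      rw [map_inv, ha, inv_inv]
      cases x with
      | none =>
        exact (base_of_inv_conj_none w a).symm ▸ mul_mem (mul_mem (inv_mem (inr_mem_fiber w _))
          (none_mem_fiber w)) (inr_mem_fiber w _)
      | some x =>
        change (base w _)⁻¹ * .inr _ * _ ∈ _
        rw [(base_commute_inr w _ _).inv_left.eq, inv_mul_cancel_right]
        exact inr_mem_fiber w _
  | mul x y hx hy =>
    have := hx _ (hy m hr)
    rw [map_mul]
    group at this ⊢
    exact this

variable {S : Type*} [Group S] (π : FreeGroup α →* S)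

theorem lift_compat (hπ : ∀ t, π (w t) = 1) (g : FreeGroup (α ⊕ τ)) :
    (π.comp (retract α)).comp (ripsAction w g).toMonoidHom =
      (MulAut.conj ((1 : FreeGroup (α ⊕ τ) →* S) g)).toMonoidHom.comp (π.comp (retract α)) := by
  refine semidirectProduct_lift_compat_of_free _ _ _ (fun x v => ?_) g
  suffices (π.comp (retract α)).comp (ripsAction w (.of x)).toMonoidHom = π.comp (retract α) by
    simpa using DFunLike.congr_fun this v
  ext1 o
  cases o with
  | some a =>
    have := ripsAction_map_some w (.of x) (.of a)
    rw [FreeGroup.map.of] at this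
    simp [this]
  | none =>
    rcases x with a | t
    · simp [ripsAction, twist_apply, twistHom_none, retract]
    · have := retract_map_some (w t)
      simp [ripsAction, twist_apply, twistHom_none, this, hπ]

variable (hπ : ∀ t, π (w t) = 1)

/-- The homomorphism to `S` extending `π` and killing all generators outside `α`. -/
def proj : RipsGroup w →* S :=
  SemidirectProduct.lift (π.comp (retract α)) 1 (lift_compat w π hπ)

theorem proj_inl (v : FreeGroup (Option α)) : proj w π hπ (.inl v) = π (retract α v) := by
  simp [proj]

theorem proj_surjective (h : Function.Surjective π) : Function.Surjective (proj w π hπ) := by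
  intro s
  obtain ⟨u, rfl⟩ := h s
  exact ⟨base w u, (proj_inl w π hπ _).trans (congrArg π (retract_map_some u))⟩

theorem proj_ker (h : π.ker = Subgroup.normalClosure (Set.range w)) :
    (proj w π hπ).ker = fiber w := by
  have := fiber_normal w
  apply le_antisymm
  · intro g hg
    have hmk (v : FreeGroup (Option α)) : (QuotientGroup.mk' (fiber w)) (.inl v) =
        QuotientGroup.mk' (fiber w) (base w (retract α v)) := by
      suffices (QuotientGroup.mk' (fiber w)).comp SemidirectProduct.inl =
          ((QuotientGroup.mk' (fiber w)).comp (base w)).comp (retract α) from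
        DFunLike.congr_fun this v
      ext1 o
      cases o with
      | none =>
        simpa [retract] using (QuotientGroup.eq_one_iff _).2 (none_mem_fiber w)
      | some a => simp [retract, base]
    have hker : retract α g.left ∈ π.ker := (mul_one _).symm.trans hg
    rw [← SemidirectProduct.inl_left_mul_inr_right g]
    refine mul_mem ?_ (inr_mem_fiber w _)
    rw [← QuotientGroup.eq_one_iff]
    refine (hmk _).trans ?_
    rw [h] at hker
    have hle : Subgroup.normalClosure (Set.range w) ≤
        ((QuotientGroup.mk' (fiber w)).comp (base w)).ker := by
      refine Subgroup.normalClosure_le_normal ?_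
      rintro _ ⟨t, rfl⟩
      exact (QuotientGroup.eq_one_iff _).2 (base_mem_fiber w t)
    exact hle hker
  · refine (Subgroup.closure_le _).2 ?_
    rintro _ ⟨_ | x, rfl⟩
    · simp [kerGen, proj, retract]
    · simp [kerGen, proj]

end RipsGroup

/-- Every finitely presented group is the quotient of a finitely presented residually finite group
by a finitely generated normal subgroup. -/
theorem exists_residuallyFinite_surjective_ker_fg (S : Type) [Group S]
    [hS : Group.IsFinitelyPresented S] :
    ∃ (G : Type) (_ : Group G) (q : G →* S), Group.IsFinitelyPresented G ∧ ResiduallyFinite G ∧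
      Function.Surjective q ∧ q.ker.FG := by
  obtain ⟨n, π, hsurj, R, hR, hker⟩ := hS.out
  have : Finite R := hR
  let w : R → FreeGroup (Fin n) := Subtype.val
  have hw : Set.range w = R := Subtype.range_val
  have hπ (t : R) : π (w t) = 1 := by
    rw [← MonoidHom.mem_ker, ← hker]
    exact Subgroup.subset_normalClosure t.2
  refine ⟨RipsGroup w, inferInstance, RipsGroup.proj w π hπ,
    isFinitelyPresented_semidirectProduct_freeGroup _, ?_, RipsGroup.proj_surjective w π hπ hsurj, ?_⟩
  · refine ResiduallyFinite.semidirectProduct _ (fun D _ _ => ?_)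
      (residuallyFinite_freeGroup _) (residuallyFinite_freeGroup _)
    exact Finite.of_equiv _ FreeGroup.lift
  · rw [RipsGroup.proj_ker w π hπ (by rw [hw, hker])]
    exact (Subgroup.fg_iff _).2 ⟨_, rfl, Set.finite_range _⟩

end RipsConstruction

section CentralExtension

open scoped commutatorElement

theorem MonoidHom.eqOn_commutator_of_inv_mul_mem_center {G H : Type*} [Group G] [Group H]
    {u v : G →* H} (h : ∀ x, (u x)⁻¹ * v x ∈ Subgroup.center H) {x : G} (hx : x ∈ commutator G) :
    u x = v x := by
  let d : G →* Subgroup.center H :=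
    MonoidHom.mk' (fun x => ⟨(u x)⁻¹ * v x, h x⟩) fun a b => Subtype.ext <| by
      have := Subgroup.mem_center_iff.1 (h a) (u b)⁻¹
      simp only [map_mul, mul_inv_rev, Subgroup.coe_mul]
      rw [← mul_assoc ((u a)⁻¹ * v a), ← this]
      group
  have hd : commutator G ≤ d.ker := by
    rw [commutator_def, Subgroup.commutator_le]
    intro a _ b _
    rw [MonoidHom.mem_ker, map_commutatorElement, commutatorElement_eq_one_iff_mul_comm]
    exact Subtype.ext (Subgroup.mem_center_iff.1 (d b).2 _)
  exact inv_mul_eq_one.1 (congrArg Subtype.val (hd hx))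

theorem map_mk'_commutator_top_le_center {F : Type*} [Group F] (R : Subgroup F) [R.Normal] :
    R.map (QuotientGroup.mk' ⁅(⊤ : Subgroup F), R⁆) ≤
      Subgroup.center (F ⧸ ⁅(⊤ : Subgroup F), R⁆) := by
  rw [← Subgroup.commutator_top_left_eq_bot_iff_le_center,
    ← Subgroup.map_top_of_surjective _ (QuotientGroup.mk'_surjective ⁅(⊤ : Subgroup F), R⁆),
    ← Subgroup.map_commutator, QuotientGroup.map_mk'_self]

/-- The class of an element of `(R ∩ [F, F]) / [F, R]` can be computed from any free presentation:
if it is trivial for one presentation of `Q`, then so is it for any other one. -/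
theorem ker_inf_commutator_le_of_freeGroup_lift {α β Q : Type*} [Group Q]
    {φ : FreeGroup α →* Q} (hφ : Function.Surjective φ)
    {ψ : FreeGroup β →* Q} (hψ : Function.Surjective ψ)
    (h : φ.ker ⊓ commutator (FreeGroup α) ≤ ⁅(⊤ : Subgroup (FreeGroup α)), φ.ker⁆) :
    ψ.ker ⊓ commutator (FreeGroup β) ≤ ⁅(⊤ : Subgroup (FreeGroup β)), ψ.ker⁆ := by
  intro z hz
  choose s hs using hφ
  choose t ht using hψ
  let f : FreeGroup β →* FreeGroup α := FreeGroup.lift fun b => s (ψ (FreeGroup.of b))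
  let g : FreeGroup α →* FreeGroup β := FreeGroup.lift fun a => t (φ (FreeGroup.of a))
  have hf : φ.comp f = ψ := FreeGroup.ext_hom _ _ fun b => by simp [f, hs]
  have hg : ψ.comp g = φ := FreeGroup.ext_hom _ _ fun a => by simp [g, ht]
  have hf' (x) : φ (f x) = ψ x := DFunLike.congr_fun hf x
  have hg' (x) : ψ (g x) = φ x := DFunLike.congr_fun hg x
  let π := QuotientGroup.mk' ⁅(⊤ : Subgroup (FreeGroup β)), ψ.ker⁆
  have hfz : f z ∈ ⁅(⊤ : Subgroup (FreeGroup α)), φ.ker⁆ :=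
    h ⟨(hf' z).trans hz.1,
      Subgroup.commutator_mono le_top le_top
        (Subgroup.map_commutator ⊤ ⊤ f ▸ Subgroup.mem_map_of_mem f hz.2)⟩
  have hgfz : g (f z) ∈ ⁅(⊤ : Subgroup (FreeGroup β)), ψ.ker⁆ :=
    Subgroup.commutator_mono le_top
      (Subgroup.map_le_iff_le_comap.2 fun x hx => by
        exact (hg' x).trans hx)
      (Subgroup.map_commutator ⊤ φ.ker g ▸ Subgroup.mem_map_of_mem g hfz)
  have key : π z = (π.comp (g.comp f)) z :=
    MonoidHom.eqOn_commutator_of_inv_mul_mem_center (fun x =>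
      map_mk'_commutator_top_le_center ψ.ker ⟨x⁻¹ * g (f x), by
        simp [MonoidHom.mem_ker, hg', hf'], by simp [π]⟩) hz.2
  rw [← QuotientGroup.eq_one_iff]
  exact key.trans ((QuotientGroup.eq_one_iff _).2 hgfz)

theorem exists_mem_ker_inf_commutator_of_nontrivial_H2 {α Q : Type*} [Group Q]
    [hQ : Nontrivial (H2 Q)] {φ : FreeGroup α →* Q} (hφ : Function.Surjective φ) :
    ∃ z ∈ φ.ker ⊓ commutator (FreeGroup α), z ∉ ⁅(⊤ : Subgroup (FreeGroup α)), φ.ker⁆ := by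
  by_contra! h
  have h' := ker_inf_commutator_le_of_freeGroup_lift hφ
    (ψ := FreeGroup.lift (id : Q → Q)) (fun q => ⟨FreeGroup.of q, by simp⟩) h
  refine not_subsingleton (H2 Q) ?_
  unfold H2
  rw [Subgroup.subgroupOf_eq_top.2 h']
  exact QuotientGroup.subsingleton_quotient_top

theorem normalClosure_eq_closure_of_subset_center {G : Type*} [Group G] {T : Set G}
    (hT : T ⊆ Subgroup.center G) : Subgroup.normalClosure T = Subgroup.closure T := by
  have : (Subgroup.closure T).Normal := by
    rw [← Subgroup.commutator_top_left_le_iff,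
      Subgroup.commutator_top_left_eq_bot_iff_le_center.2 ((Subgroup.closure_le _).2 hT)]
    exact bot_le
  exact le_antisymm (Subgroup.normalClosure_le_normal Subgroup.subset_closure)
    Subgroup.closure_le_normalClosure

/-- Over a free group on a finite set, the commutator subgroup with a normal closure of finitely
many elements is normally generated by the commutators of the generators. -/
theorem isFinitelyNormallyGenerated_commutator_top {α : Type*} [Finite α]
    {R : Subgroup (FreeGroup α)} [R.Normal] (hR : R.IsFinitelyNormallyGenerated) :
    ⁅(⊤ : Subgroup (FreeGroup α)), R⁆.IsFinitelyNormallyGenerated := by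
  obtain ⟨S, hS, hSR⟩ := hR
  set T : Set (FreeGroup α) :=
    Set.image2 (fun a s => ⁅(FreeGroup.of a : FreeGroup α), s⁆) Set.univ S with hT
  refine ⟨T, Set.finite_univ.image2 _ hS, ?_⟩
  refine le_antisymm (Subgroup.normalClosure_le_normal ?_) ?_
  · rintro _ ⟨a, -, s, hs, rfl⟩
    exact Subgroup.commutator_mem_commutator trivial (hSR ▸ Subgroup.subset_normalClosure hs)
  · let π : FreeGroup α →* _ := QuotientGroup.mk' (Subgroup.normalClosure T)
    have hRπ : R ≤ (Subgroup.center _).comap π := by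
      rw [← hSR]
      refine Subgroup.normalClosure_le_normal fun s hs => ?_
      refine Subgroup.mem_center_iff.2 fun y => ?_
      obtain ⟨y, rfl⟩ := QuotientGroup.mk'_surjective _ y
      have : (MulAut.conj (π s)).toMonoidHom.comp π = π := by
        refine FreeGroup.ext_hom _ _ fun a => ?_
        have : π ⁅FreeGroup.of a, s⁆ = 1 := (QuotientGroup.eq_one_iff _).2
          (Subgroup.subset_normalClosure ⟨a, trivial, s, hs, rfl⟩)
        rw [map_commutatorElement, commutatorElement_eq_one_iff_mul_comm] at this
        simp [MulAut.conj_apply, ← this]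
      have := DFunLike.congr_fun this y
      exact (mul_inv_eq_iff_eq_mul.1 this).symm
    rw [Subgroup.commutator_le]
    intro x _ r hr
    rw [← QuotientGroup.eq_one_iff]
    change π ⁅x, r⁆ = 1
    rw [map_commutatorElement, commutatorElement_eq_one_iff_mul_comm]
    exact Subgroup.mem_center_iff.1 (hRπ hr) (π x)

/-- A finitely presented group with nontrivial second homology has a finitely presented central
extension, with finitely generated kernel, that meets the commutator subgroup
nontrivially. -/
theorem exists_central_extension_of_nontrivial_H2 (Q : Type) [Group Q]
    [hfp : Group.IsFinitelyPresented Q] [Nontrivial (H2 Q)] :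
    ∃ (E : Type) (_ : Group E) (e : E →* Q), Group.IsFinitelyPresented E ∧
      Function.Surjective e ∧ e.ker ≤ Subgroup.center E ∧ e.ker.FG ∧
      ∃ z ∈ e.ker ⊓ commutator E, z ≠ 1 := by
  obtain ⟨n, φ, hφ, hR⟩ := hfp
  obtain ⟨z, hz, hz'⟩ := exists_mem_ker_inf_commutator_of_nontrivial_H2 hφ
  have hle : ⁅(⊤ : Subgroup (FreeGroup (Fin n))), φ.ker⁆ ≤ φ.ker := Subgroup.commutator_le_right _ _
  have hker : (QuotientGroup.lift _ φ hle).ker = φ.ker.map (QuotientGroup.mk' _) :=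
    QuotientGroup.ker_lift _ _ _
  have hcenter := map_mk'_commutator_top_le_center φ.ker
  refine ⟨FreeGroup (Fin n) ⧸ ⁅(⊤ : Subgroup (FreeGroup (Fin n))), φ.ker⁆, inferInstance,
    QuotientGroup.lift _ φ hle,
    Group.IsFinitelyPresented.quotient _ (isFinitelyNormallyGenerated_commutator_top hR),
    QuotientGroup.lift_surjective_of_surjective _ _ hφ _, hker ▸ hcenter, ?_,
    QuotientGroup.mk z, ⟨hz.1, ?_⟩, mt (QuotientGroup.eq_one_iff z).1 hz'⟩
  · obtain ⟨S, hS, hSR⟩ := hR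
    have hmap := Subgroup.map_normalClosure S
      (QuotientGroup.mk' ⁅(⊤ : Subgroup (FreeGroup (Fin n))), φ.ker⁆)
      (QuotientGroup.mk'_surjective _)
    rw [normalClosure_eq_closure_of_subset_center (T := _ '' _)] at hmap
    · exact (Subgroup.fg_iff _).2
        ⟨_, hmap.symm.trans ((congrArg _ hSR).trans hker.symm), hS.image _⟩
    · rintro _ ⟨s, hs, rfl⟩
      exact hcenter ⟨s, hSR ▸ Subgroup.subset_normalClosure hs, rfl⟩
  · exact Subgroup.commutator_mono le_top le_top
      (Subgroup.map_commutator ⊤ ⊤ (QuotientGroup.mk' ⁅(⊤ : Subgroup (FreeGroup (Fin n))), φ.ker⁆) ▸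
        Subgroup.mem_map_of_mem _ hz.2)

theorem Subgroup.FG.comap_of_ker_fg {G H : Type*} [Group G] [Group H] {q : G →* H}
    (hq : Function.Surjective q) (hker : q.ker.FG) {K : Subgroup H} (hK : K.FG) :
    (K.comap q).FG := by
  obtain ⟨S, rfl, hS⟩ := (Subgroup.fg_iff _).1 hK
  have : Subgroup.comap q (Subgroup.closure S) =
      Subgroup.closure (Function.surjInv hq '' S) ⊔ q.ker := by
    rw [← Subgroup.comap_map_eq, MonoidHom.map_closure, ← Set.image_comp]
    simp [Function.surjInv_eq]
  rw [this]
  exact ((Subgroup.fg_iff _).2 ⟨_, rfl, hS.image _⟩).sup hker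

/-- In a central extension of a group without nontrivial finite quotients, every finite-index normal
subgroup contains the commutator subgroup. -/
theorem commutator_le_of_noNontrivialFiniteQuotients {E Q : Type} [Group E] [Group Q]
    (hnq : NoNontrivialFiniteQuotients Q) {e : E →* Q} (he : Function.Surjective e)
    (hcenter : e.ker ≤ Subgroup.center E) (L : Subgroup E) [L.Normal] [L.FiniteIndex] :
    commutator E ≤ L := by
  have : (L ⊔ e.ker).FiniteIndex := Subgroup.finiteIndex_of_le le_sup_left
  have htop : L ⊔ e.ker = ⊤ := by
    refine (Subgroup.eq_top_iff' _).2 fun x => ?_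
    let π : {g : E →* E ⧸ (L ⊔ e.ker) // e.ker ≤ g.ker} :=
      ⟨QuotientGroup.mk' _, (QuotientGroup.ker_mk' (L ⊔ e.ker)).symm ▸ le_sup_right⟩
    rw [← QuotientGroup.eq_one_iff, ← hnq _ (e.liftOfSurjective he π) (e x)]
    exact (MonoidHom.liftOfRightInverse_comp_apply e _ (Function.rightInverse_surjInv he) π x).symm
  rw [commutator_def, Subgroup.commutator_le]
  intro x _ y _
  obtain ⟨l, hl, a, ha, rfl⟩ := Subgroup.mem_sup_of_normal_left.1 (htop.ge (Subgroup.mem_top x))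
  have : ⁅l * a, y⁆ = ⁅l, y⁆ := by
    have := Subgroup.mem_center_iff.1 (hcenter ha) y
    simp only [commutatorElement_def, mul_inv_rev, mul_assoc]
    congr 1
    rw [← mul_assoc a, ← this]
    group
  rw [this]
  exact Subgroup.commutator_le_left L ⊤ (Subgroup.commutator_mem_commutator hl trivial)

end CentralExtension

/-- **Proposition 1.1.** If `Q` is finitely presented, has no nontrivial finite
quotients, and `H₂(Q;ℤ) ≠ 0`, then there is a finitely presented, residually finite
group `G` and a finitely generated, residually finite normal subgroup `N ◁ G` with
`G ⧸ N ≅ Q` (i.e. `N = ker p` for a surjection `p : G → Q`) such that the induced map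
of profinite completions `N̂ → Ĝ` is not injective. -/
theorem exists_fp_residually_finite_with_profinite_not_inj
    (Q : Type) [Group Q] (hfp : FinitelyPresentedGroup Q)
    (hnq : NoNontrivialFiniteQuotients Q) (hH2 : Nontrivial (H2 Q)) :
    ∃ (G : Type) (_ : Group G) (p : G →* Q),
      FinitelyPresentedGroup G ∧ ResiduallyFinite G ∧ Function.Surjective p ∧
        p.ker.FG ∧ ResiduallyFinite ↥p.ker ∧ ¬ ProfiniteInj p.ker := by
  have := finitelyPresentedGroup_iff.1 hfp
  obtain ⟨E, _, e, _, he, hcenter, hfg, z, ⟨hzker, hzcomm⟩, hz⟩ :=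
    exists_central_extension_of_nontrivial_H2 Q
  obtain ⟨G, _, q, hG, hGrf, hq, hqfg⟩ := exists_residuallyFinite_surjective_ker_fg E
  refine ⟨G, inferInstance, e.comp q, finitelyPresentedGroup_iff.2 hG, hGrf, he.comp hq,
    Subgroup.FG.comap_of_ker_fg hq hqfg hfg, hGrf.subgroup _, fun hinj => ?_⟩
  let _ : CommGroup e.ker :=
    { (inferInstance : Group e.ker) with
      mul_comm := fun a b => Subtype.ext (Subgroup.mem_center_iff.1 (hcenter b.2) a) }
  have : Group.FG e.ker := (Group.fg_iff_subgroup_fg _).2 hfg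
  obtain ⟨D, _, _, f, hf⟩ := residuallyFinite_of_commGroup_fg e.ker ⟨z, hzker⟩
    fun h => hz (congrArg Subtype.val h)
  let r : (e.comp q).ker →* e.ker :=
    (q.comp (e.comp q).ker.subtype).codRestrict e.ker fun x => x.2
  obtain ⟨L, hL, _, hLM⟩ := hinj (f.comp r).ker inferInstance inferInstance
  have : (L.map q).Normal := hL.map q hq
  have : (L.map q).FiniteIndex :=
    ⟨ne_zero_of_dvd_ne_zero Subgroup.FiniteIndex.index_ne_zero (L.index_map_dvd hq)⟩
  obtain ⟨l, hl, rfl⟩ := commutator_le_of_noNontrivialFiniteQuotients hnq he hcenter (L.map q) hzcomm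
  exact hf (hLM (x := ⟨l, hzker⟩) hl)
end

section
/- Let G be a group and let I ≤ N be normal subgroups of G. Suppose that every homomorphism from G onto a finite group remains surjective when restricted to I, and that the quotient N/I has a nontrivial finite quotient. Then the map of profinite completions induced by the inclusion N ↪ G is not injective; that is, there exists a finite-index normal subgroup M of N such that no finite-index normal subgroup L of G satisfies L ∩ N ≤ M. -/
/-- If `I ≤ N` are normal subgroups of `G`, every homomorphism from `G` onto a finite
group remains surjective when restricted to `I`, and `N/I` has a nontrivial finite
quotient (i.e. there is a surjection from `N` onto a nontrivial finite group killing
`I`), then the map of profinite completions induced by `N ↪ G` is not injective. -/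
theorem profinite_not_inj_of_dense_normal_sub
    (G : Type) [Group G] (I N : Subgroup G) [I.Normal] [N.Normal] (hIN : I ≤ N)
    (hsurj : ProfiniteSurj I)
    (hquot : ∃ (H : Type) (_ : Group H) (_ : Finite H) (f : ↥N →* H),
      Function.Surjective f ∧ Nontrivial H ∧ I.subgroupOf N ≤ f.ker) :
    ¬ ProfiniteInj N := by
  intro hinj
  obtain ⟨H, _, _, f, hf, _, hker⟩ := hquot
  obtain ⟨L, _, _, hLM⟩ := hinj f.ker inferInstance inferInstance
  obtain ⟨h, hh⟩ := exists_ne (1 : H)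
  obtain ⟨n, rfl⟩ := hf h
  obtain ⟨i, hi⟩ := hsurj (G ⧸ L) (QuotientGroup.mk' L) (QuotientGroup.mk'_surjective L) n
  have hi_ker : (⟨i, hIN i.2⟩ : N) ∈ f.ker := hker i.2
  have hdiff_L : (i : G)⁻¹ * n ∈ L := QuotientGroup.eq.1 hi
  have hdiff : (⟨i, hIN i.2⟩ : N)⁻¹ * n ∈ f.ker := hLM (Subgroup.mem_subgroupOf.2 hdiff_L)
  exact hh ((Subgroup.mul_mem_cancel_left _ (inv_mem hi_ker)).1 hdiff)
end

section
/- Let E be a perfect group and Z a subgroup of the center of E such that the quotient E/Z has no nontrivial finite quotients. Then E has no nontrivial finite quotients. -/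
/-- A perfect central extension of a group with no nontrivial finite quotients has no
nontrivial finite quotients: if `E` is perfect, `Z ≤ Z(E)`, and `E ⧸ Z` has no
nontrivial finite quotients (i.e. every homomorphism from `E` to a finite group killing
`Z` is trivial), then `E` has no nontrivial finite quotients. -/
theorem no_finite_quotients_of_perfect_central_extension
    (E : Type) [Group E] (Z : Subgroup E) (hZ : Z ≤ Subgroup.center E)
    (hperf : commutator E = ⊤)
    (hquot : ∀ (H : Type) [Group H] [Finite H] (f : E →* H), Z ≤ f.ker → ∀ x, f x = 1) :
    NoNontrivialFiniteQuotients E := by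
  intro H _ _ f q
  have hcentral (x : E) : f.rangeRestrict x ∈ Subgroup.center f.range := by
    rw [← QuotientGroup.eq_one_iff]
    refine hquot _ ((QuotientGroup.mk' (Subgroup.center f.range)).comp f.rangeRestrict) ?_ x
    intro z hz
    refine (QuotientGroup.eq_one_iff _).2 (Subgroup.mem_center_iff.2 ?_)
    rintro ⟨_, y, rfl⟩
    ext
    simpa using congrArg f (Subgroup.mem_center_iff.1 (hZ hz) y)
  have hker : commutator E ≤ f.ker := by
    rw [commutator_def, Subgroup.commutator_le]
    intro x _ y _
    rw [MonoidHom.mem_ker, map_commutatorElement, commutatorElement_eq_one_iff_mul_comm]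
    exact congrArg Subtype.val (Subgroup.mem_center_iff.1 (hcentral y) (f.rangeRestrict x))
  exact hker (hperf ▸ Subgroup.mem_top q)
end

section
/- Let G be a group, and suppose the trivial ℤ[G]-module ℤ admits a free resolution of the form 0 → ℤ[G]^r → ℤ[G]^g → ℤ[G] → ℤ → 0 (an exact sequence of ℤ[G]-modules with the displayed finitely generated free modules) with r > g. Then H₂(G;ℤ) ≠ 0. -/
open MonoidAlgebra in
/-- The augmentation `ℤ[G] → ℤ`. -/
noncomputable def augmentation (G : Type*) [Group G] : MonoidAlgebra ℤ G →ₐ[ℤ] ℤ :=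
  lift ℤ ℤ G 1

@[simp]
lemma augmentation_single {G : Type*} [Group G] (x : G) (n : ℤ) :
    augmentation G (.single x n) = n := by
  simp [augmentation]

/-- A `ℤ[G]`-linear map between finite free modules preserves the vanishing of all
coordinatewise augmentations. -/
lemma augmentation_map_eq_zero {G ι κ : Type*} [Group G] [Fintype ι] [DecidableEq ι]
    (f : (ι → MonoidAlgebra ℤ G) →ₗ[MonoidAlgebra ℤ G] (κ → MonoidAlgebra ℤ G))
    {x : ι → MonoidAlgebra ℤ G} (hx : ∀ i, augmentation G (x i) = 0) (k : κ) :
    augmentation G (f x k) = 0 := by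
  rw [f.pi_apply_eq_sum_univ x]
  simp [hx]

namespace FoxCalculus

variable {G : Type*} [Group G]

/-- The action of the free group on `G` on the free module `ℤ[G]^(G)` by affine maps for which
the generator `x` acts by `q ↦ e_x + x • q`. -/
noncomputable def affineAction : FreeGroup G →* Equiv.Perm (G →₀ MonoidAlgebra ℤ G) :=
  FreeGroup.lift fun x =>
    { toFun := fun q => Finsupp.single x 1 + MonoidAlgebra.of ℤ G x • q
      invFun := fun q => MonoidAlgebra.of ℤ G x⁻¹ • (q - Finsupp.single x 1)
      left_inv := fun q => by
        beta_reduce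
        rw [add_sub_cancel_left, smul_smul, ← map_mul, inv_mul_cancel, map_one, one_smul]
      right_inv := fun q => by
        beta_reduce
        rw [smul_smul, ← map_mul, mul_inv_cancel, map_one, one_smul, add_sub_cancel] }

lemma affineAction_add (w : FreeGroup G) (q q' : G →₀ MonoidAlgebra ℤ G) :
    affineAction w (q + q') =
      affineAction w q + MonoidAlgebra.of ℤ G (FreeGroup.lift id w) • q' := by
  induction w using FreeGroup.induction_on generalizing q q' with
  | C1 => simp [← MonoidAlgebra.one_def]
  | of x => simp [affineAction, add_assoc]
  | inv_of x ih =>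
    apply (affineAction (FreeGroup.of x)).injective
    rw [ih, ← Equiv.Perm.mul_apply, ← Equiv.Perm.mul_apply, ← map_mul, mul_inv_cancel, smul_smul,
      ← map_mul, ← map_mul, mul_inv_cancel]
    simp [← MonoidAlgebra.one_def]
  | mul u v hu hv => rw [map_mul, Equiv.Perm.mul_apply, hv, hu, smul_smul, ← map_mul, ← map_mul,
      Equiv.Perm.mul_apply]

/-- The total Fox derivative `FreeGroup G → ℤ[G]^(G)`. -/
noncomputable def foxD (w : FreeGroup G) : G →₀ MonoidAlgebra ℤ G := affineAction w 0

@[simp]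
lemma foxD_of (x : G) : foxD (FreeGroup.of x) = Finsupp.single x 1 := by
  simp [foxD, affineAction]

@[simp]
lemma foxD_one : foxD (1 : FreeGroup G) = 0 := by simp [foxD]

lemma foxD_mul (u v : FreeGroup G) :
    foxD (u * v) = foxD u + MonoidAlgebra.of ℤ G (FreeGroup.lift id u) • foxD v := by
  have h := affineAction_add u 0 (foxD v)
  rw [zero_add] at h
  rw [foxD, map_mul]
  exact h

lemma foxD_inv (u : FreeGroup G) :
    foxD u⁻¹ = -(MonoidAlgebra.of ℤ G (FreeGroup.lift id u⁻¹) • foxD u) := by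
  have h := foxD_mul u⁻¹ u
  rw [inv_mul_cancel, foxD_one] at h
  exact eq_neg_of_add_eq_zero_left h.symm

lemma foxD_mul_inv_of_eq {u v : FreeGroup G}
    (h : FreeGroup.lift (id : G → G) u = FreeGroup.lift id v) :
    foxD (u * v⁻¹) = foxD u - foxD v := by
  rw [foxD_mul, foxD_inv, h, smul_neg, smul_smul, ← map_mul, ← map_mul, mul_inv_cancel, map_one,
    map_one, one_smul, sub_eq_add_neg]

open scoped commutatorElement in
lemma foxD_commutator (w : FreeGroup G) {ρ : FreeGroup G}
    (hρ : ρ ∈ (FreeGroup.lift (id : G → G)).ker) :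
    foxD ⁅w, ρ⁆ = (MonoidAlgebra.of ℤ G (FreeGroup.lift id w) - 1) • foxD ρ := by
  have hρ' : FreeGroup.lift (id : G → G) ρ = 1 := hρ
  rw [commutatorElement_def, mul_assoc (w * ρ), ← mul_inv_rev, foxD_mul_inv_of_eq (by simp [hρ']),
    foxD_mul, foxD_mul ρ, hρ', sub_smul, map_one, one_smul, one_smul]
  abel

/-- The Fox derivatives of the relators, as an additive subgroup. -/
noncomputable def relatorDerivatives (G : Type*) [Group G] :
    AddSubgroup (G →₀ MonoidAlgebra ℤ G) where
  carrier := {q | ∃ ρ ∈ (FreeGroup.lift (id : G → G)).ker, foxD ρ = q}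
  zero_mem' := ⟨1, one_mem _, foxD_one⟩
  add_mem' := by
    rintro _ _ ⟨a, ha, rfl⟩ ⟨b, hb, rfl⟩
    refine ⟨a * b, mul_mem ha hb, ?_⟩
    rw [foxD_mul, MonoidHom.mem_ker.1 ha, map_one, one_smul]
  neg_mem' := by
    rintro _ ⟨a, ha, rfl⟩
    refine ⟨a⁻¹, inv_mem ha, ?_⟩
    rw [foxD_inv, MonoidHom.mem_ker.1 (inv_mem ha), map_one, one_smul]

/-- The map `ℤ[G]^(G) → ℤ[G]` sending `e_x` to `x - 1`. -/
noncomputable def toAugmentationIdeal (G : Type*) [Group G] :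
    (G →₀ MonoidAlgebra ℤ G) →ₗ[MonoidAlgebra ℤ G] MonoidAlgebra ℤ G :=
  Finsupp.linearCombination _ fun x => MonoidAlgebra.of ℤ G x - 1

lemma toAugmentationIdeal_foxD (w : FreeGroup G) :
    toAugmentationIdeal G (foxD w) = MonoidAlgebra.of ℤ G (FreeGroup.lift id w) - 1 := by
  induction w using FreeGroup.induction_on with
  | C1 => simp [← MonoidAlgebra.one_def]
  | of x => simp [toAugmentationIdeal]
  | inv_of x ih =>
    rw [foxD_inv, map_neg, map_smul, ih, smul_eq_mul, mul_sub, ← map_mul, ← map_mul,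
      inv_mul_cancel, map_one, map_one, mul_one, neg_sub]
  | mul u v hu hv =>
    rw [foxD_mul, map_add, map_smul, hu, hv, smul_eq_mul, mul_sub, ← map_mul, ← map_mul, mul_one]
    abel

/-- The additive map `ℤ[G] → ℤ[G]^(G)` sending `x` to `e_x`. -/
noncomputable def basisLift (G : Type*) [Group G] :
    MonoidAlgebra ℤ G →+ (G →₀ MonoidAlgebra ℤ G) :=
  (Finsupp.mapRange.addMonoidHom (Int.castAddHom _)).comp MonoidAlgebra.coeffAddEquiv.toAddMonoidHom

@[simp]
lemma basisLift_single (x : G) (n : ℤ) :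
    basisLift G (.single x n) = Finsupp.single x (n : MonoidAlgebra ℤ G) := by
  simp [basisLift]

lemma toAugmentationIdeal_basisLift (a : MonoidAlgebra ℤ G) :
    toAugmentationIdeal G (basisLift G a) = a - (augmentation G a : MonoidAlgebra ℤ G) := by
  induction a using MonoidAlgebra.induction_linear with
  | zero => simp
  | add a b ha hb => rw [map_add, map_add, ha, hb, map_add, Int.cast_add]; abel
  | single x n =>
    simp [toAugmentationIdeal, mul_sub, ← zsmul_eq_mul]

lemma sub_basisLift_mem (q : G →₀ MonoidAlgebra ℤ G) :
    q - basisLift G (toAugmentationIdeal G q) ∈ relatorDerivatives G := by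
  induction q using Finsupp.induction_linear with
  | zero => simp
  | add p q hp hq =>
    rw [map_add, map_add, add_sub_add_comm]
    exact add_mem hp hq
  | single x a =>
    induction a using MonoidAlgebra.induction_linear with
    | zero => simp
    | add a b ha hb =>
      rw [Finsupp.single_add, map_add, map_add, add_sub_add_comm]
      exact add_mem ha hb
    | single y n =>
      have key : foxD (FreeGroup.of y * FreeGroup.of x * (FreeGroup.of (y * x))⁻¹) =
          Finsupp.single y 1 + Finsupp.single x (MonoidAlgebra.single y 1) -
            Finsupp.single (y * x) 1 := by
        rw [foxD_mul_inv_of_eq (by simp), foxD_mul]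
        simp
      have hmem : Finsupp.single y 1 + Finsupp.single x (MonoidAlgebra.single y 1) -
            Finsupp.single (y * x) 1 ∈ relatorDerivatives G :=
        ⟨_, by simp [MonoidHom.mem_ker], key⟩
      convert zsmul_mem hmem n using 1
      simp [toAugmentationIdeal, mul_sub, smul_sub, smul_add, MonoidAlgebra.single_mul_single]
      abel

/-- Every element of the kernel of `ℤ[G]^(G) → ℤ[G]` is the Fox derivative of a relator. -/
lemma exists_foxD_eq {q : G →₀ MonoidAlgebra ℤ G} (hq : toAugmentationIdeal G q = 0) :
    ∃ ρ ∈ (FreeGroup.lift (id : G → G)).ker, foxD ρ = q := by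
  have h := sub_basisLift_mem q
  rwa [hq, map_zero, sub_zero] at h

/-- A word whose Fox derivative has vanishing augmentations is a product of commutators. -/
lemma mem_commutator_of_augmentation_foxD {w : FreeGroup G}
    (hw : ∀ x, augmentation G (foxD w x) = 0) : w ∈ commutator (FreeGroup G) := by
  let ab (w : FreeGroup G) : FreeAbelianGroup G := Additive.ofMul (Abelianization.of w)
  have ab_one : ab 1 = 0 := rfl
  have ab_of (y : G) : ab (FreeGroup.of y) = FreeAbelianGroup.of y := rfl
  have ab_inv (u : FreeGroup G) : ab u⁻¹ = -ab u := rfl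
  have ab_mul (u v : FreeGroup G) : ab (u * v) = ab u + ab v := rfl
  have key (w : FreeGroup G) (x : G) :
      augmentation G (foxD w x) = FreeAbelianGroup.toFinsupp (ab w) x := by
    induction w using FreeGroup.induction_on with
    | C1 => simp [ab_one]
    | of y =>
      classical
      rw [ab_of, foxD_of, FreeAbelianGroup.toFinsupp_of, Finsupp.single_apply, Finsupp.single_apply]
      split_ifs <;> simp
    | inv_of y ih =>
      rw [ab_inv, map_neg, Finsupp.neg_apply, ← ih, foxD_inv, Finsupp.neg_apply, map_neg,
        Finsupp.smul_apply, smul_eq_mul, map_mul, MonoidAlgebra.of_apply, augmentation_single,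
        one_mul]
    | mul u v hu hv =>
      rw [ab_mul, map_add, Finsupp.add_apply, ← hu, ← hv, foxD_mul]
      simp
  rw [← Abelianization.ker_of, MonoidHom.mem_ker]
  have h0 : FreeAbelianGroup.toFinsupp (ab w) = 0 := by
    ext x
    rw [← key, hw, Finsupp.zero_apply]
  exact (FreeAbelianGroup.equivFinsupp G).injective (h0.trans (map_zero _).symm)

end FoxCalculus

lemma mem_commutator_of_subsingleton_H2 {G : Type*} [Group G] [h : Subsingleton (H2 G)]
    {w : FreeGroup G} (hw : w ∈ (FreeGroup.lift (id : G → G)).ker)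
    (hw' : w ∈ commutator (FreeGroup G)) :
    w ∈ ⁅(⊤ : Subgroup (FreeGroup G)), (FreeGroup.lift (id : G → G)).ker⁆ := by
  have := QuotientGroup.eq.1 (@Subsingleton.elim _ h (QuotientGroup.mk 1)
    (QuotientGroup.mk ⟨w, hw, hw'⟩))
  simpa [Subgroup.mem_subgroupOf] using this

/-- Any `ℤ[G]`-linear map onto the trivial module `ℤ` has the augmentation ideal as kernel. -/
lemma eq_zero_iff_augmentation_eq_zero {G : Type*} [Group G]
    {ε : MonoidAlgebra ℤ G →ₗ[MonoidAlgebra ℤ G]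
      (Representation.trivial ℤ (G := G) (V := ℤ)).asModule}
    (hε : Function.Surjective ε) (a : MonoidAlgebra ℤ G) :
    ε a = 0 ↔ augmentation G a = 0 := by
  have key (a : MonoidAlgebra ℤ G) : ε a = augmentation G a • ε 1 := by
    induction a using MonoidAlgebra.induction_linear with
    | zero => simp
    | add a b ha hb => rw [map_add, ha, hb, map_add, add_smul]
    | single x n =>
      have : (MonoidAlgebra.single x n : MonoidAlgebra ℤ G) = MonoidAlgebra.single x n • 1 := by
        simp
      rw [this, map_smul, Representation.single_smul]
      simp
      rfl
  have h1 : ε 1 ≠ 0 := by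
    intro h
    obtain ⟨a, ha⟩ := hε (show ℤ from 1)
    rw [key, h, smul_zero] at ha
    exact zero_ne_one (α := ℤ) ha
  rw [key]
  exact mul_eq_zero (M₀ := ℤ).trans (or_iff_left h1)

open FoxCalculus in
/-- **Corollary 2.2 (homological form).** If the trivial `ℤ[G]`-module `ℤ` admits a free
resolution `0 → ℤ[G]^r → ℤ[G]^g → ℤ[G] → ℤ → 0` with `r > g`, then `H₂(G;ℤ) ≠ 0`. -/
theorem H2_nontrivial_of_short_free_resolution
    (G : Type) [Group G] (r g : ℕ) (hrg : r > g)
    (d2 : (Fin r → MonoidAlgebra ℤ G) →ₗ[MonoidAlgebra ℤ G] (Fin g → MonoidAlgebra ℤ G))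
    (d1 : (Fin g → MonoidAlgebra ℤ G) →ₗ[MonoidAlgebra ℤ G] MonoidAlgebra ℤ G)
    (ε : MonoidAlgebra ℤ G →ₗ[MonoidAlgebra ℤ G]
      (Representation.trivial ℤ (G := G) (V := ℤ)).asModule)
    (hd2 : Function.Injective d2) (h21 : Function.Exact d2 d1)
    (h1ε : Function.Exact d1 ε) (hε : Function.Surjective ε) :
    Nontrivial (H2 G) := by
  by_contra hH
  have hsub : Subsingleton (H2 G) := not_nontrivial_iff_subsingleton.1 hH
  have hd1 (p) : d1 (d2 p) = 0 := (h21 _).2 ⟨p, rfl⟩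
  obtain ⟨X, hX, hXne⟩ : ∃ X : Fin r → MonoidAlgebra ℤ G,
      (∀ i, augmentation G (d2 X i) = 0) ∧ ∃ j, augmentation G (X j) ≠ 0 := by
    let M : (Fin r → ℤ) →ₗ[ℤ] (Fin g → ℤ) :=
      (augmentation G).toLinearMap.compLeft (Fin g) ∘ₗ d2.restrictScalars ℤ ∘ₗ
        (Algebra.linearMap ℤ (MonoidAlgebra ℤ G)).compLeft (Fin r)
    have hM : ¬ Function.Injective M := fun h => by
      have := LinearMap.finrank_le_finrank_of_injective h
      simp at this
      omega
    obtain ⟨z, hz, hz0⟩ : ∃ z, M z = 0 ∧ z ≠ 0 := by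
      simpa [injective_iff_map_eq_zero] using hM
    obtain ⟨j, hj⟩ := Function.ne_iff.1 hz0
    refine ⟨fun i => algebraMap ℤ _ (z i), fun i => congrFun hz i, j, ?_⟩
    simpa using hj
  obtain ⟨φ, hφ⟩ : ∃ φ : (Fin g → MonoidAlgebra ℤ G) →ₗ[MonoidAlgebra ℤ G]
      (G →₀ MonoidAlgebra ℤ G), toAugmentationIdeal G ∘ₗ φ = d1 := by
    refine ⟨Fintype.linearCombination _ fun i => basisLift G (d1 (Pi.single i 1)), ?_⟩
    ext i : 2
    have h := (eq_zero_iff_augmentation_eq_zero hε _).1 ((h1ε _).2 ⟨Pi.single i 1, rfl⟩)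
    simp [toAugmentationIdeal_basisLift, h]
  obtain ⟨ψ, hψ⟩ : ∃ ψ : (G →₀ MonoidAlgebra ℤ G) →ₗ[MonoidAlgebra ℤ G]
      (Fin g → MonoidAlgebra ℤ G), d1 ∘ₗ ψ = toAugmentationIdeal G := by
    have h (x : G) : ∃ p, d1 p = MonoidAlgebra.of ℤ G x - 1 :=
      (h1ε _).1 ((eq_zero_iff_augmentation_eq_zero hε _).2 (by simp))
    choose p hp using h
    refine ⟨Finsupp.linearCombination _ p, ?_⟩
    ext x : 2
    simp [toAugmentationIdeal, hp]
  obtain ⟨κ, hκ⟩ : ∃ κ : (Fin g → MonoidAlgebra ℤ G) →ₗ[MonoidAlgebra ℤ G]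
      (Fin r → MonoidAlgebra ℤ G), ∀ p, ψ (φ p) = p + d2 (κ p) := by
    have h (i : Fin g) : ∃ k, d2 k = ψ (φ (Pi.single i 1)) - Pi.single i 1 := by
      refine (h21 _).1 ?_
      rw [map_sub, ← LinearMap.comp_apply, hψ, ← LinearMap.comp_apply, hφ, sub_self]
    choose k hk using h
    refine ⟨Fintype.linearCombination _ k, fun p => ?_⟩
    suffices ψ ∘ₗ φ = LinearMap.id + d2 ∘ₗ Fintype.linearCombination _ k from
      LinearMap.congr_fun this p
    ext i : 2
    simp [hk]
  obtain ⟨ρ, hρ, hρX⟩ : ∃ ρ ∈ (FreeGroup.lift (id : G → G)).ker, foxD ρ = φ (d2 X) := by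
    refine exists_foxD_eq ?_
    rw [← LinearMap.comp_apply, hφ, hd1]
  have hρ' : ρ ∈ commutator (FreeGroup G) := by
    refine mem_commutator_of_augmentation_foxD fun x => ?_
    rw [hρX]
    exact augmentation_map_eq_zero (Finsupp.lcoeFun ∘ₗ φ) hX x
  let S : Subgroup (FreeGroup G) :=
    { carrier := {w | w ∈ (FreeGroup.lift (id : G → G)).ker ∧
        ∃ Z, (∀ j, augmentation G (Z j) = 0) ∧ ψ (foxD w) = d2 Z}
      one_mem' := ⟨one_mem _, 0, by simp, by simp⟩
      mul_mem' := by
        rintro a b ⟨ha, Z, hZ, haZ⟩ ⟨hb, W, hW, hbW⟩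
        refine ⟨mul_mem ha hb, Z + W, by simp [hZ, hW], ?_⟩
        rw [foxD_mul, MonoidHom.mem_ker.1 ha, map_one, one_smul, map_add, haZ, hbW, map_add]
      inv_mem' := by
        rintro a ⟨ha, Z, hZ, haZ⟩
        refine ⟨inv_mem ha, -Z, by simp [hZ], ?_⟩
        rw [foxD_inv, MonoidHom.mem_ker.1 (inv_mem ha), map_one, one_smul, map_neg, haZ, map_neg] }
  have hS : ⁅(⊤ : Subgroup (FreeGroup G)), (FreeGroup.lift (id : G → G)).ker⁆ ≤ S := by
    refine Subgroup.commutator_le.2 fun w _ σ hσ => ?_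
    obtain ⟨Z, hZ⟩ : ∃ Z, d2 Z = ψ (foxD σ) := by
      refine (h21 _).1 ?_
      rw [← LinearMap.comp_apply, hψ, toAugmentationIdeal_foxD, MonoidHom.mem_ker.1 hσ, map_one,
        sub_self]
    refine ⟨?_, (MonoidAlgebra.of ℤ G (FreeGroup.lift id w) - 1) • Z, by simp, ?_⟩
    · simp [MonoidHom.mem_ker, map_commutatorElement, MonoidHom.mem_ker.1 hσ]
    · rw [foxD_commutator w hσ, map_smul, map_smul, hZ]
  obtain ⟨-, Z, hZ, hρZ⟩ := hS (mem_commutator_of_subsingleton_H2 hρ hρ')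
  rw [hρX, hκ, ← map_add] at hρZ
  obtain ⟨j, hj⟩ := hXne
  apply hj
  have h := hZ j
  rw [← hd2 hρZ, Pi.add_apply, map_add, augmentation_map_eq_zero κ hX, add_zero] at h
  exact h
end
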